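/- Let $K$ be an algebraically closed field of characteristic $0$, complete with respect to a non-trivial (possibly non-archimedean) absolute value $|\cdot|$, and let $f\in K(z)$ be a rational function of degree $d>1$. Notation. Let $\mathsf P^1$ be the Berkovich projective line over $K$, which contains $\mathbb P^1=\mathbb P^1(K)$ as a dense subset. Let $\|\cdot\|$ be the maximum norm on $K^2$ if $K$ is non-archimedean and the Euclidean norm if $K$ is archimedean, and let $[z,w]=|p_0q_1-p_1q_0|/(\|p\|\,\|q\|)$ be the normalized chordal metric on $\mathbb P^1$, where $p,q\in K^2\setminus\{0\}$ represent $z,w$. Let $[x,y]_{\mathrm{can}}=\limsup_{\mathbb P^1\times\mathbb P^1\ni(z,w)\to(x,y)}[z,w]$ be the generalized Hsia kernel on $\mathsf P^1$ (which is the chordal metric if $K$ is archimedean). A continuous function $g:\mathsf P^1\to\mathbb R$ is a continuous weight with measure $\mu^g$ if $\mu^g$ is a probability Radon measure on $\mathsf P^1$ with $\Delta g+\Omega_{\mathrm{can}}=\mu^g$, where $\Delta$ is the Laplacian normalized by $\Delta\log[\cdot,y]_{\mathrm{can}}=\delta_y-\Omega_{\mathrm{can}}$ for all $y \in \mathsf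 P^1$ and $\Omega_{\mathrm{can}}$ is the Dirac mass at the Gauss point ($K$ non-archimedean) or the normalized Fubini--Study area ($K$ archimedean); that is, $g=\int_{\mathsf P^1}\log[\cdot,y]_{\mathrm{can}}\,d\mu^g(y)+\mathrm{const}$ on $\mathsf P^1$. Such a $g$ is normalized if $$V_g:=\sup_\nu\iint_{\mathsf P^1\times\mathsf P^1}\bigl(\log[x,y]_{\mathrm{can}}-g(x)-g(y)\bigr)\,d\nu(x)\,d\nu(y)=0,$$ the supremum being over all probability Radon measures $\nu$ on $\mathsf P^1$. Let $F:K^2\to K^2$ be a non-degenerate homogeneous polynomial lift of $f$, and let $g_F=\lim_{n\to\infty}d^{-n}T_{F^n}$, where $T_{F^n}$ is the continuous extension to $\mathsf P^1$ of the function on $\mathbb P^1$ induced by $\log\|F^n\|-d^n\log\|\cdot\|$. The equilibrium measure of $f$ is $\mu_f:=\mu^{g_F}$ (it does not depend on $F$), and the dynamical Green function $g_f$ is the unique normalized weight with $\mu^{g_f}=\mu_f$. Denote the continuous extension of $f$ to $\mathsf P^1$ again by $f$. For $n\ge1$ let $[f^n,\mathrm{Id}]_{\mathrm{can}}$ be the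 continuous extension to $\mathsf P^1$ of $z\mapsto[f^n(z),z]$, and set $$\Phi(f^n,\mathrm{Id})_{g_f}:=\log[f^n,\mathrm{Id}]_{\mathrm{can}}-g_f\circ f^n-g_f .$$ Then, for every $n\ge1$, the function $\Phi(f^n,\mathrm{Id})_{g_f}$ is finite $\mu_f$-almost everywhere and $\mu_f$-integrable, and $$\int_{\mathsf P^1}\Phi(f^n,\mathrm{Id})_{g_f}\,d\mu_f=O(n)\qquad\text{as }n\to\infty .$$ -/

import Mathlib

open Filter Topology MeasureTheory Asymptotics
open scoped Polynomial ENNReal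

noncomputable section

namespace BerkDyn

/-! ### The classical projective line, its chordal metric, and rational maps -/

section Classical

variable {K : Type*} [NormedField K]

open Classical in
/-- The norm on `K²`: the maximum norm if `K` is non-archimedean, the Euclidean norm if `K` is
archimedean. -/
def vecNorm (p : K × K) : ℝ :=
  if IsNonarchimedean (fun a : K => ‖a‖) then max ‖p.1‖ ‖p.2‖
  else Real.sqrt (‖p.1‖ ^ 2 + ‖p.2‖ ^ 2)

/-- The wedge product on `K²`. -/
def wedge (p q : K × K) : K := p.1 * q.2 - p.2 * q.1

/-- Homogeneous coordinates on `ℙ¹(K) = K ∪ {∞}`: `z ↦ (z, 1)` and `∞ ↦ (1, 0)`.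
Here and below `OnePoint K` serves only as the set `K ∪ {∞}`; its topology is never used. -/
def coords : OnePoint K → K × K
  | some z => (z, 1)
  | none => (1, 0)

open Classical in
/-- The projection `K² ∖ {0} → ℙ¹(K)`, `(p₀, p₁) ↦ p₀ / p₁`. -/
def proj (p : K × K) : OnePoint K :=
  if p.2 = 0 then OnePoint.infty else ((p.1 / p.2 : K) : OnePoint K)

/-- The normalized chordal metric `[z, w] = |p ∧ q| / (‖p‖ ‖q‖)` on `ℙ¹(K)`. -/
def chordal (z w : OnePoint K) : ℝ :=
  ‖wedge (coords z) (coords w)‖ / (vecNorm (coords z) * vecNorm (coords w))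

/-- The degree of a rational function. -/
def ratDegree (f : RatFunc K) : ℕ := max f.num.natDegree f.denom.natDegree

/-- The value at `p ∈ K²` of the homogenization of degree `d` of a polynomial `P`. -/
def homEval (d : ℕ) (P : K[X]) (p : K × K) : K :=
  ∑ i ∈ Finset.range (d + 1), P.coeff i * p.1 ^ i * p.2 ^ (d - i)

/-- The non-degenerate homogeneous lift `F : K² → K²` of `f` given by its reduced numerator and
denominator. Any other lift is `c • F` with `c ∈ K ∖ {0}`. -/
def lift (f : RatFunc K) (p : K × K) : K × K :=
  (homEval (ratDegree f) f.num p, homEval (ratDegree f) f.denom p)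

/-- The action of `f` on `ℙ¹(K)`. -/
def ratMap (f : RatFunc K) (z : OnePoint K) : OnePoint K := proj (lift f (coords z))

/-- `T_{Fⁿ} = log ‖Fⁿ‖ - dⁿ log ‖·‖` on `ℙ¹(K)`. -/
def liftHeight (f : RatFunc K) (n : ℕ) (z : OnePoint K) : ℝ :=
  Real.log (vecNorm ((lift f)^[n] (coords z)))
    - (ratDegree f : ℝ) ^ n * Real.log (vecNorm (coords z))

end Classical

/-! ### The Berkovich projective line -/

/-- The Berkovich affine line: the multiplicative seminorms on `K[X]` that extend the absolute
value of `K`. -/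
def BerkA1 (K : Type*) [NormedField K] : Type _ :=
  {x : MulRingSeminorm K[X] // ∀ a : K, x (Polynomial.C a) = ‖a‖}

/-- The weakest topology for which `x ↦ |P|_x` is continuous for every polynomial `P`. -/
instance (K : Type*) [NormedField K] : TopologicalSpace (BerkA1 K) :=
  TopologicalSpace.induced (fun (x : BerkA1 K) (P : K[X]) => x.1 P) inferInstance

/-- The Berkovich projective line `𝖯¹(K)`: the one-point compactification of the (locally
compact) Berkovich affine line. For archimedean `K` this is `ℙ¹(K)`. -/
def BerkP1 (K : Type*) [NormedField K] : Type _ := OnePoint (BerkA1 K)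

instance (K : Type*) [NormedField K] : TopologicalSpace (BerkP1 K) :=
  inferInstanceAs (TopologicalSpace (OnePoint (BerkA1 K)))

instance (K : Type*) [NormedField K] : Nonempty (BerkP1 K) :=
  inferInstanceAs (Nonempty (OnePoint (BerkA1 K)))

instance (K : Type*) [NormedField K] : MeasurableSpace (BerkP1 K) := borel _

instance (K : Type*) [NormedField K] : BorelSpace (BerkP1 K) := ⟨rfl⟩

section Berkovich

variable {K : Type*} [NormedField K]

/-- The classical point `a ∈ K` as the seminorm `P ↦ |P(a)|`. -/
def evalPoint (a : K) : BerkA1 K :=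
  ⟨{ toFun := fun P => ‖P.eval a‖
     map_zero' := by simp
     map_one' := by simp
     map_mul' := by simp
     add_le' := fun P Q => by simpa using norm_add_le (P.eval a) (Q.eval a)
     neg' := by simp },
    fun b => by
      change ‖(Polynomial.C b).eval a‖ = ‖b‖
      simp⟩

/-- The inclusion `ℙ¹(K) → 𝖯¹(K)`, with dense image. -/
def incl (z : OnePoint K) : BerkP1 K := OnePoint.map evalPoint z

/-- The trace on `ℙ¹(K)` of the neighbourhood filter of `x ∈ 𝖯¹(K)`: the filter of classical
points tending to `x`. -/
def approach (x : BerkP1 K) : Filter (OnePoint K) := comap incl (𝓝 x)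

/-- The continuous extension to `𝖯¹(K)` of a function `φ` on `ℙ¹(K)`, that is
`x ↦ lim_{ℙ¹ ∋ z → x} φ(z)`. -/
def extend {Y : Type*} [TopologicalSpace Y] [Nonempty Y] (φ : OnePoint K → Y)
    (x : BerkP1 K) : Y :=
  limUnder (approach x) φ

/-- The generalized Hsia kernel with respect to the canonical (Gauss) point:
`[x, y]_can = limsup [z, w]` as the classical points `z, w` tend to `x, y`. For archimedean `K`
this is the chordal metric itself. -/
def hsia (x y : BerkP1 K) : ℝ :=
  limsup (fun p : OnePoint K × OnePoint K => chordal p.1 p.2) (approach x ×ˢ approach y)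

/-- `-log [x, y]_can ∈ [0, ∞]` (recall `[x, y]_can ≤ 1`). -/
def negLogHsia (x y : BerkP1 K) : ℝ≥0∞ :=
  (-ENNReal.log (ENNReal.ofReal (hsia x y))).toENNReal

/-! ### Potential theory -/

/-- `IsWeight g μ`: the function `g` is a continuous weight and `μ` is the probability Radon
measure `μ^g = Δ g + Ω_can`.

The Laplacian `Δ` is the operator with kernel the constants and
`Δ (∫ log [·, y]_can dν(y)) = ν - ν(𝖯¹) Ω_can` for Radon measures `ν`. Hence
`Δ g + Ω_can = μ` means that `g = ∫ log [·, y]_can dμ(y) + c` for a constant `c`. -/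
structure IsWeight (g : BerkP1 K → ℝ) (μ : Measure (BerkP1 K)) : Prop where
  continuous : Continuous g
  isProbabilityMeasure : IsProbabilityMeasure μ
  regular : μ.Regular
  potential : ∃ c : ℝ, ∀ x,
    ((∫⁻ y, negLogHsia x y ∂μ : ℝ≥0∞) : EReal) = ((c - g x : ℝ) : EReal)

/-- The energy `∬ Φ_g d(ν × ν) ∈ [-∞, ∞)` of a probability measure `ν`, where
`Φ_g(x, y) = log [x, y]_can - g(x) - g(y)`. -/
def energy (g : BerkP1 K → ℝ) (ν : Measure (BerkP1 K)) : EReal :=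
  -((∫⁻ x, ∫⁻ y, negLogHsia x y ∂ν ∂ν : ℝ≥0∞) : EReal) - ((2 * ∫ x, g x ∂ν : ℝ) : EReal)

/-- The `g`-equilibrium energy `V_g`: the supremum of the energy over all probability Radon
measures on `𝖯¹`. -/
def equilibriumEnergy (g : BerkP1 K → ℝ) : EReal :=
  ⨆ (ν : Measure (BerkP1 K)) (_ : IsProbabilityMeasure ν) (_ : ν.Regular), energy g ν

/-! ### Dynamics of a rational function -/

/-- The extension of `f` to `𝖯¹`. -/
def berkMap (f : RatFunc K) : BerkP1 K → BerkP1 K := extend fun z => incl (ratMap f z)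

/-- `g_F = lim_n T_{Fⁿ} / dⁿ` on `𝖯¹`. -/
def liftGreen (f : RatFunc K) (x : BerkP1 K) : ℝ :=
  limUnder atTop fun n : ℕ => extend (liftHeight f n) x / (ratDegree f : ℝ) ^ n

/-- `μ` is the equilibrium (canonical) measure `μ_f = Δ g_F + Ω_can` of `f`. Replacing `F` by
another lift adds a constant to `g_F` and does not change the measure. -/
def IsEquilibriumMeasure (f : RatFunc K) (μ : Measure (BerkP1 K)) : Prop :=
  IsWeight (liftGreen f) μ

/-- `g` is the dynamical Green function `g_f` of `f`: the normalized weight (`V_g = 0`) with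
`μ^g = μ_f`. -/
def IsDynamicalGreen (f : RatFunc K) (g : BerkP1 K → ℝ) : Prop :=
  (∃ μ, IsEquilibriumMeasure f μ ∧ IsWeight g μ) ∧ equilibriumEnergy g = 0

/-- `[fⁿ, Id]_can`, the continuous extension to `𝖯¹` of `z ↦ [fⁿ(z), z]`. -/
def prox (f : RatFunc K) (n : ℕ) : BerkP1 K → ℝ :=
  extend fun z => chordal ((ratMap f)^[n] z) z

/-- The logarithmic proximity function
`Φ(fⁿ, Id)_g = log [fⁿ, Id]_can - g ∘ fⁿ - g`. It is meant where `[fⁿ, Id]_can > 0`; elsewhere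
its true value is `-∞`. -/
def logProx (f : RatFunc K) (g : BerkP1 K → ℝ) (n : ℕ) (x : BerkP1 K) : ℝ :=
  Real.log (prox f n x) - g ((berkMap f)^[n] x) - g x

end Berkovich

end BerkDyn

end

open Filter Topology MeasureTheory Asymptotics
open scoped Polynomial ENNReal

noncomputable section

namespace BerkDyn

/-! ### Topology of the Berkovich line -/

section Topology

variable {K : Type*} [NormedField K]

theorem BerkA1.ext {x y : BerkA1 K} (h : ∀ P : K[X], x.1 P = y.1 P) : x = y :=
  Subtype.ext (DFunLike.ext _ _ h)

theorem continuous_seminorm (P : K[X]) : Continuous fun x : BerkA1 K => x.1 P :=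
  (continuous_apply P).comp continuous_induced_dom

theorem tendsto_berkA1 {α : Type*} {l : Filter α} {u : α → BerkA1 K} {x : BerkA1 K} :
    Tendsto u l (𝓝 x) ↔ ∀ P : K[X], Tendsto (fun i => (u i).1 P) l (𝓝 (x.1 P)) := by
  rw [nhds_induced, tendsto_comap_iff, tendsto_pi_nhds]
  rfl

instance : T2Space (BerkA1 K) :=
  T2Space.of_injective_continuous (f := fun (x : BerkA1 K) (P : K[X]) => x.1 P)
    (fun _ _ h => BerkA1.ext fun P => congrFun h P) continuous_induced_dom

theorem seminorm_sum_le (x : BerkA1 K) {ι : Type*} (s : Finset ι) (u : ι → K[X]) :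
    x.1 (∑ i ∈ s, u i) ≤ ∑ i ∈ s, x.1 (u i) := by
  classical
  induction s using Finset.induction_on with
  | empty => simp
  | insert i s hi ih =>
    rw [Finset.sum_insert hi, Finset.sum_insert hi]
    exact (map_add_le_add _ _ _).trans (by gcongr)

theorem seminorm_le_sum (x : BerkA1 K) (P : K[X]) :
    x.1 P ≤ ∑ i ∈ Finset.range (P.natDegree + 1), ‖P.coeff i‖ * x.1 Polynomial.X ^ i := by
  conv_lhs => rw [P.as_sum_range_C_mul_X_pow]
  refine (seminorm_sum_le x _ _).trans (Finset.sum_le_sum fun i _ => ?_)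
  rw [map_mul, map_pow, x.2]

theorem isClosedEmbedding_seminorm :
    IsClosedEmbedding (fun (x : BerkA1 K) (P : K[X]) => x.1 P) := by
  refine ⟨⟨⟨rfl⟩, fun _ _ h => BerkA1.ext fun P => congrFun h P⟩, ?_⟩
  have : Set.range (fun (x : BerkA1 K) (P : K[X]) => x.1 P) =
      {u | u 0 = 0} ∩ {u | u 1 = 1} ∩ {u | ∀ P Q, u (P * Q) = u P * u Q} ∩
      {u | ∀ P Q, u (P + Q) ≤ u P + u Q} ∩ {u | ∀ P, u (-P) = u P} ∩
      {u | ∀ a : K, u (Polynomial.C a) = ‖a‖} := by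
    ext u
    constructor
    · rintro ⟨x, rfl⟩
      exact ⟨⟨⟨⟨⟨map_zero x.1, map_one x.1⟩, fun P Q => map_mul x.1 P Q⟩,
        fun P Q => map_add_le_add x.1 P Q⟩, fun P => map_neg_eq_map x.1 P⟩, x.2⟩
    · rintro ⟨⟨⟨⟨⟨h0, h1⟩, hm⟩, ha⟩, hn⟩, hC⟩
      exact ⟨⟨{ toFun := u, map_zero' := h0, map_one' := h1, map_mul' := hm, add_le' := ha,
                neg' := hn }, hC⟩, rfl⟩
  rw [this]
  refine IsClosed.inter (IsClosed.inter (IsClosed.inter (IsClosed.inter (IsClosed.inter ?_ ?_) ?_)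
    ?_) ?_) ?_
  · exact isClosed_eq (continuous_apply _) continuous_const
  · exact isClosed_eq (continuous_apply _) continuous_const
  · simp only [Set.ofPred_forall]
    exact isClosed_iInter fun P => isClosed_iInter fun Q =>
      isClosed_eq (continuous_apply _) (by fun_prop)
  · simp only [Set.ofPred_forall]
    exact isClosed_iInter fun P => isClosed_iInter fun Q =>
      isClosed_le (continuous_apply _) (by fun_prop)
  · simp only [Set.ofPred_forall]
    exact isClosed_iInter fun P => isClosed_eq (continuous_apply _) (continuous_apply _)
  · simp only [Set.ofPred_forall]
    exact isClosed_iInter fun P => isClosed_eq (continuous_apply _) continuous_const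

theorem isCompact_closedDisc (R : ℝ) : IsCompact {x : BerkA1 K | x.1 Polynomial.X ≤ R} := by
  have hK : IsCompact (Set.univ.pi fun P : K[X] =>
      Set.Icc (0 : ℝ) (∑ i ∈ Finset.range (P.natDegree + 1), ‖P.coeff i‖ * R ^ i)) :=
    isCompact_univ_pi fun _ => isCompact_Icc
  refine (isClosedEmbedding_seminorm.isCompact_preimage hK).of_isClosed_subset
    (isClosed_le (continuous_seminorm _) continuous_const) fun x hx P _ => ?_
  refine ⟨apply_nonneg x.1 P, (seminorm_le_sum x P).trans (Finset.sum_le_sum fun i _ => ?_)⟩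
  have hx' : x.1 Polynomial.X ≤ R := hx
  gcongr

instance : WeaklyLocallyCompactSpace (BerkA1 K) where
  exists_compact_mem_nhds x := ⟨_, isCompact_closedDisc (x.1 Polynomial.X + 1),
    (continuous_seminorm _).continuousAt.preimage_mem_nhds (Iic_mem_nhds (lt_add_one _))⟩

instance : T2Space (BerkP1 K) := inferInstanceAs (T2Space (OnePoint (BerkA1 K)))

instance : CompactSpace (BerkP1 K) := inferInstanceAs (CompactSpace (OnePoint (BerkA1 K)))

theorem tendsto_seminorm_X_coclosedCompact :
    Tendsto (fun x : BerkA1 K => x.1 Polynomial.X) (coclosedCompact _) atTop := by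
  rw [coclosedCompact_eq_cocompact]
  refine tendsto_atTop.2 fun R => ?_
  filter_upwards [(isCompact_closedDisc (K := K) R).compl_mem_cocompact] with x hx
  exact (not_le.1 fun h => hx h).le

end Topology

/-! ### Density of the classical points -/

section Density

variable {K : Type*} [NontriviallyNormedField K]

theorem le_of_forall_pow_le_mul_pow {a M : ℝ} (hM : 0 ≤ M)
    (h : ∀ n : ℕ, a ^ n ≤ (n + 1) * M ^ n) : a ≤ M := by
  by_contra! hlt
  have ha' : 0 < a := hM.trans_lt hlt
  have hr : M / a < 1 := (div_lt_one ha').2 hlt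
  have hr0 : 0 ≤ M / a := by positivity
  have h1 : Tendsto (fun n : ℕ => ((n : ℝ) + 1) * (M / a) ^ n) atTop (𝓝 0) := by
    have := (tendsto_self_mul_const_pow_of_lt_one hr0 hr).add
      (tendsto_pow_atTop_nhds_zero_of_lt_one hr0 hr)
    simpa [add_mul] using this
  refine absurd (ge_of_tendsto' h1 fun n => ?_) (not_le.2 one_pos)
  rw [div_pow, ← mul_div_assoc, le_div_iff₀ (by positivity), one_mul]
  exact h n

theorem seminorm_X_sub_C_add_le (x : BerkA1 K) (a b : K) :
    x.1 (Polynomial.X - Polynomial.C a) ≤ x.1 (Polynomial.X - Polynomial.C b) + ‖a - b‖ := by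
  have : (Polynomial.X - Polynomial.C a : K[X]) =
      (Polynomial.X - Polynomial.C b) + Polynomial.C (b - a) := by
    rw [Polynomial.C_sub]; ring
  rw [this, ← norm_sub_rev, ← x.2]
  exact map_add_le_add _ _ _

theorem norm_sub_le_seminorm_add (x : BerkA1 K) (a b : K) :
    ‖a - b‖ ≤ x.1 (Polynomial.X - Polynomial.C a) + x.1 (Polynomial.X - Polynomial.C b) := by
  have : (Polynomial.C (a - b) : K[X]) =
      -(Polynomial.X - Polynomial.C a) + (Polynomial.X - Polynomial.C b) := by
    rw [Polynomial.C_sub]; ring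
  rw [← x.2, this, ← map_neg_eq_map x.1 (Polynomial.X - Polynomial.C a)]
  exact map_add_le_add _ _ _

theorem norm_natCast_le_one_of_isNonarchimedean (h : IsNonarchimedean fun a : K => ‖a‖) (n : ℕ) :
    ‖(n : K)‖ ≤ 1 := by
  induction n with
  | zero => simp
  | succ n ih => push_cast; exact (h _ _).trans (by simp [ih])

theorem seminorm_add_le_max (h : IsNonarchimedean fun a : K => ‖a‖) (x : BerkA1 K) (P Q : K[X]) :
    x.1 (P + Q) ≤ max (x.1 P) (x.1 Q) := by
  set M := max (x.1 P) (x.1 Q) with hMdef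
  have hM : 0 ≤ M := (apply_nonneg x.1 P).trans (le_max_left _ _)
  refine le_of_forall_pow_le_mul_pow hM fun n => ?_
  rw [← map_pow, add_pow]
  refine (seminorm_sum_le x _ _).trans ?_
  have hb : ∀ k ∈ Finset.range (n + 1),
      x.1 (P ^ k * Q ^ (n - k) * ((n.choose k : ℕ) : K[X])) ≤ M ^ n := by
    intro k hk
    have hk' : k ≤ n := Nat.lt_succ_iff.1 (Finset.mem_range.1 hk)
    rw [map_mul, map_mul, map_pow, map_pow, ← Polynomial.C_eq_natCast, x.2]
    have h1 : x.1 P ^ k ≤ M ^ k := pow_le_pow_left₀ (apply_nonneg _ _) (le_max_left _ _) _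
    have h2 : x.1 Q ^ (n - k) ≤ M ^ (n - k) :=
      pow_le_pow_left₀ (apply_nonneg _ _) (le_max_right _ _) _
    calc _ ≤ M ^ k * M ^ (n - k) * 1 := by
          gcongr
          exact norm_natCast_le_one_of_isNonarchimedean h _
      _ = M ^ n := by rw [mul_one, ← pow_add, Nat.add_sub_cancel' hk']
  refine (Finset.sum_le_card_nsmul _ _ _ hb).trans ?_
  simp

theorem seminorm_X_sub_C_le_max (h : IsNonarchimedean fun a : K => ‖a‖) (x : BerkA1 K) (a b : K) :
    x.1 (Polynomial.X - Polynomial.C a) ≤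
      max (x.1 (Polynomial.X - Polynomial.C b)) ‖a - b‖ := by
  have : (Polynomial.X - Polynomial.C a : K[X]) =
      (Polynomial.X - Polynomial.C b) + Polynomial.C (b - a) := by
    rw [Polynomial.C_sub]; ring
  rw [this, ← norm_sub_rev, ← x.2]
  exact seminorm_add_le_max h x _ _

variable [IsAlgClosed K]

theorem seminorm_eq_prod_roots (x : BerkA1 K) (P : K[X]) :
    x.1 P = ‖P.leadingCoeff‖ *
      (P.roots.map fun b => x.1 (Polynomial.X - Polynomial.C b)).prod := by
  conv_lhs => rw [(IsAlgClosed.splits P).eq_prod_roots]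
  rw [map_mul, x.2, map_multiset_prod, Multiset.map_map]
  rfl

/-- Convergence in the Berkovich line is detected by the polynomials of degree one. -/
theorem tendsto_berkA1_of_X_sub_C {α : Type*} {l : Filter α} {u : α → BerkA1 K} {x : BerkA1 K}
    (h : ∀ b : K, Tendsto (fun i => (u i).1 (Polynomial.X - Polynomial.C b)) l
      (𝓝 (x.1 (Polynomial.X - Polynomial.C b)))) : Tendsto u l (𝓝 x) := by
  refine tendsto_berkA1.2 fun P => ?_
  simp only [fun y : BerkA1 K => seminorm_eq_prod_roots y P]
  exact (tendsto_multiset_prod _ fun b _ => h b).const_mul _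

theorem exists_norm_mem_Ioo {r s : ℝ} (hr : 0 < r) (hrs : r < s) : ∃ y : K, r < ‖y‖ ∧ ‖y‖ < s := by
  obtain ⟨t, ht⟩ := NormedField.exists_one_lt_norm K
  have hq : 1 < s / r := (one_lt_div hr).2 hrs
  obtain ⟨n, hn⟩ := pow_unbounded_of_one_lt ‖t‖ hq
  have hn0 : n ≠ 0 := by rintro rfl; simp at hn; linarith
  obtain ⟨u, hu⟩ := IsAlgClosed.exists_pow_nat_eq t (Nat.pos_of_ne_zero hn0)
  have hun : ‖u‖ ^ n = ‖t‖ := by rw [← norm_pow, hu]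
  have hu1 : 1 < ‖u‖ := by
    by_contra! hle
    have := pow_le_one₀ (n := n) (norm_nonneg u) hle
    linarith
  have hu2 : ‖u‖ < s / r := lt_of_pow_lt_pow_left₀ n (by positivity) (hun ▸ hn)
  obtain ⟨k, hk1, hk2⟩ := exists_mem_Ico_zpow hr hu1
  refine ⟨u ^ (k + 1), by rwa [norm_zpow], ?_⟩
  rw [norm_zpow, zpow_add_one₀ (by positivity)]
  calc ‖u‖ ^ k * ‖u‖ ≤ r * ‖u‖ := by gcongr
    _ < r * (s / r) := by gcongr
    _ = s := by field_simp

theorem exists_seminorm_X_sub_C_approx (h : IsNonarchimedean fun a : K => ‖a‖) (x : BerkA1 K)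
    (S : Finset K) {ε : ℝ} (hε : 0 < ε) :
    ∃ a : K, ∀ b ∈ S, |‖a - b‖ - x.1 (Polynomial.X - Polynomial.C b)| < ε := by
  rcases S.eq_empty_or_nonempty with rfl | hS
  · exact ⟨0, by simp⟩
  obtain ⟨b₀, hb₀, hmin⟩ := S.exists_min_image
    (fun b => x.1 (Polynomial.X - Polynomial.C b)) hS
  set r := x.1 (Polynomial.X - Polynomial.C b₀) with hr
  rcases (apply_nonneg x.1 (Polynomial.X - Polynomial.C b₀)).eq_or_lt with h0 | h0
  · refine ⟨b₀, fun b _ => lt_of_le_of_lt ?_ hε⟩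
    have h1 := seminorm_X_sub_C_add_le x b b₀
    have h2 := norm_sub_le_seminorm_add x b₀ b
    rw [norm_sub_rev] at h1
    rw [← h0] at h1 h2
    rw [abs_le]; constructor <;> linarith
  have hev : ∀ᶠ s in 𝓝[>] r, ∀ b ∈ S, r < ‖b - b₀‖ → s < ‖b - b₀‖ := by
    refine (Filter.eventually_all_finset S).2 fun b _ => ?_
    by_cases hb : r < ‖b - b₀‖
    · filter_upwards [Ioo_mem_nhdsGT hb] with s hs _ using hs.2
    · exact Eventually.of_forall fun s hs => absurd hs hb
  obtain ⟨s, hs1, hs2⟩ := (hev.and (Ioo_mem_nhdsGT (show r < r + ε by linarith))).exists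
  obtain ⟨y, hy1, hy2⟩ := exists_norm_mem_Ioo (K := K) h0 hs2.1
  have hna : ∀ u v : K, ‖u‖ < ‖v‖ → ‖u + v‖ = ‖v‖ := by
    intro u v huv
    refine le_antisymm ((h u v).trans (by simp [huv.le])) ?_
    have := h (-u) (u + v)
    simp only [neg_add_cancel_left, norm_neg] at this
    rcases le_max_iff.1 this with h' | h'
    · exact absurd h' huv.not_ge
    · exact h'
  refine ⟨b₀ + y, fun b hb => ?_⟩
  have hle := seminorm_X_sub_C_le_max h x b b₀
  by_cases hbr : r < ‖b - b₀‖
  · have e1 : ‖b₀ + y - b‖ = ‖b - b₀‖ := by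
      rw [show b₀ + y - b = y + (b₀ - b) by ring, hna _ _ (by
        rw [norm_sub_rev b₀ b]; exact hy2.trans (hs1 b hb hbr)), norm_sub_rev]
    have e2 : ‖b - b₀‖ ≤ x.1 (Polynomial.X - Polynomial.C b) := by
      have h4 : (Polynomial.C (b - b₀) : K[X]) =
          (Polynomial.X - Polynomial.C b₀) + -(Polynomial.X - Polynomial.C b) := by
        rw [Polynomial.C_sub]; ring
      have h3 := seminorm_add_le_max h x (Polynomial.X - Polynomial.C b₀)
        (-(Polynomial.X - Polynomial.C b))
      rw [← h4, x.2, map_neg_eq_map] at h3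
      rcases le_max_iff.1 h3 with h' | h'
      · exact absurd h' hbr.not_ge
      · exact h'
    rw [max_eq_right hbr.le] at hle
    rw [e1, le_antisymm hle e2, sub_self, abs_zero]
    exact hε
  · have hbr' := not_lt.1 hbr
    have e1 : ‖b₀ + y - b‖ = ‖y‖ := by
      rw [show b₀ + y - b = (b₀ - b) + y by ring, hna _ _ (by
        rw [norm_sub_rev b₀ b]; exact hbr'.trans_lt hy1)]
    rw [max_eq_left hbr'] at hle
    rw [e1, le_antisymm hle (hmin b hb), abs_lt]
    constructor <;> linarith [hs2.2]

theorem exists_seminorm_near_inf (x : BerkA1 K) {r : ℝ} (hr : 0 < r)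
    (hinf : ∀ a : K, r ≤ x.1 (Polynomial.X - Polynomial.C a)) {c : K} (hc : ‖c‖ ≤ r / 2)
    {η : ℝ} (hη : 0 < η) :
    ∃ ε > 0, ∀ a : K, x.1 (Polynomial.X - Polynomial.C a) ≤ r * (1 + ε) →
      x.1 (Polynomial.X - Polynomial.C (a + c)) ≤ r * (1 + η) := by
  classical
  obtain ⟨n, hn⟩ : ∃ n : ℕ, (1 / 2 : ℝ) ^ n < η / 2 :=
    exists_pow_lt_of_lt_one (by positivity) (by norm_num)
  have hcont : Tendsto (fun ε : ℝ => (1 + ε) ^ (n + 1)) (𝓝[>] 0) (𝓝 1) := by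
    have : Continuous fun ε : ℝ => (1 + ε) ^ (n + 1) := by fun_prop
    simpa using (this.tendsto 0).mono_left nhdsWithin_le_nhds
  obtain ⟨ε, hε1, hε2⟩ := ((hcont.eventually (gt_mem_nhds
    (show (1 : ℝ) < 1 + η / 2 by linarith))).and self_mem_nhdsWithin).exists
  refine ⟨ε, hε2, fun a ha => ?_⟩
  set Q : K[X] := (Polynomial.X - Polynomial.C a) ^ (n + 1) - Polynomial.C (c ^ (n + 1)) with hQ
  have hmonic : Q.Monic := by
    have h1 : ((Polynomial.X - Polynomial.C a) ^ (n + 1) : K[X]).Monic :=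
      (Polynomial.monic_X_sub_C a).pow _
    refine h1.sub_of_left ?_
    rw [Polynomial.degree_pow, Polynomial.degree_X_sub_C]
    exact Polynomial.degree_C_le.trans_lt (by simp; exact_mod_cast Nat.succ_pos n)
  have hdeg : Q.natDegree = n + 1 := by
    rw [hQ, Polynomial.natDegree_sub_C, Polynomial.natDegree_pow, Polynomial.natDegree_X_sub_C,
      mul_one]
  have hroot : a + c ∈ Q.roots := by
    rw [Polynomial.mem_roots hmonic.ne_zero, Polynomial.IsRoot.def, hQ]
    simp
  have hQx := seminorm_eq_prod_roots x Q
  rw [hmonic.leadingCoeff, norm_one, one_mul, ← Multiset.cons_erase hroot, Multiset.map_cons,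
    Multiset.prod_cons] at hQx
  have hcard : (Q.roots.erase (a + c)).card = n := by
    rw [Multiset.card_erase_of_mem hroot, ← (IsAlgClosed.splits Q).natDegree_eq_card_roots, hdeg]
    rfl
  have hlow : r ^ n ≤ ((Q.roots.erase (a + c)).map
      fun b => x.1 (Polynomial.X - Polynomial.C b)).prod := by
    rw [← hcard]
    generalize Q.roots.erase (a + c) = s
    induction s using Multiset.induction_on with
    | empty => simp
    | cons b s ih =>
      rw [Multiset.card_cons, Multiset.map_cons, Multiset.prod_cons, pow_succ, mul_comm]
      exact mul_le_mul (hinf b) ih (by positivity) (apply_nonneg _ _)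
  have hup : x.1 Q ≤ r ^ (n + 1) * (1 + η) := by
    have h1 : x.1 Q ≤ x.1 (Polynomial.X - Polynomial.C a) ^ (n + 1) + ‖c‖ ^ (n + 1) := by
      rw [← map_pow, ← norm_pow, ← x.2]
      exact map_sub_le_add _ _ _
    have h2 : x.1 (Polynomial.X - Polynomial.C a) ^ (n + 1) ≤ (r * (1 + ε)) ^ (n + 1) :=
      pow_le_pow_left₀ (apply_nonneg _ _) ha _
    have h3 : ‖c‖ ^ (n + 1) ≤ (r * (1 / 2)) ^ (n + 1) :=
      pow_le_pow_left₀ (norm_nonneg _) (hc.trans_eq (by ring)) _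
    rw [mul_pow] at h2 h3
    have h4 : (1 / 2 : ℝ) ^ (n + 1) ≤ η / 2 := by
      rw [pow_succ]; nlinarith [pow_pos (show (0 : ℝ) < 1 / 2 by norm_num) n]
    have hrn : 0 < r ^ (n + 1) := by positivity
    nlinarith
  have hrn : 0 < r ^ n := by positivity
  have h5 : x.1 (Polynomial.X - Polynomial.C (a + c)) * r ^ n ≤ r * (1 + η) * r ^ n := by
    calc _ ≤ x.1 Q := by rw [hQx]; gcongr
      _ ≤ _ := hup.trans_eq (by ring)
  exact le_of_mul_le_mul_right h5 hrn

/-- A Gelfand–Mazur argument: over an archimedean field, every point of the Berkovich line is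
arbitrarily close to classical points. -/
theorem exists_seminorm_X_sub_C_lt (h : ¬ IsNonarchimedean fun a : K => ‖a‖) (x : BerkA1 K)
    {δ : ℝ} (hδ : 0 < δ) : ∃ a : K, x.1 (Polynomial.X - Polynomial.C a) < δ := by
  by_contra! hcon
  set r := ⨅ a : K, x.1 (Polynomial.X - Polynomial.C a) with hr
  have hbdd : BddBelow (Set.range fun a : K => x.1 (Polynomial.X - Polynomial.C a)) :=
    ⟨0, by rintro _ ⟨a, rfl⟩; exact apply_nonneg _ _⟩
  have hinf : ∀ a : K, r ≤ x.1 (Polynomial.X - Polynomial.C a) := fun a => ciInf_le hbdd a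
  have hr0 : 0 < r := hδ.trans_le (le_ciInf hcon)
  obtain ⟨c, hc0, hc⟩ := NormedField.exists_norm_lt K (show 0 < r / 2 by positivity)
  have hnat : ∃ m : ℕ, 1 < ‖(m : K)‖ := by
    by_contra! hle
    have := IsUltrametricDist.isUltrametricDist_of_forall_norm_natCast_le_one hle
    exact h fun a b => IsUltrametricDist.norm_add_le_max a b
  obtain ⟨m, hm⟩ := hnat
  obtain ⟨k, hk⟩ := pow_unbounded_of_one_lt (4 * r / ‖c‖) hm
  have key : ∀ N : ℕ, ∀ η > 0, ∃ ε > 0, ∀ a : K,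
      x.1 (Polynomial.X - Polynomial.C a) ≤ r * (1 + ε) →
      x.1 (Polynomial.X - Polynomial.C (a + (N : K) * c)) ≤ r * (1 + η) := by
    intro N
    induction N with
    | zero => intro η hη; exact ⟨η, hη, fun a ha => by simpa using ha⟩
    | succ N ih =>
      intro η hη
      obtain ⟨ε, hε, h1⟩ := exists_seminorm_near_inf x hr0 hinf hc.le hη
      obtain ⟨ε', hε', h2⟩ := ih ε hε
      refine ⟨ε', hε', fun a ha => ?_⟩
      have := h1 _ (h2 a ha)
      rwa [add_assoc, ← add_one_mul, ← Nat.cast_succ] at this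
  obtain ⟨ε, hε, hkey⟩ := key (m ^ k) 1 one_pos
  obtain ⟨a, ha⟩ := exists_lt_of_ciInf_lt
    (show r < r * (1 + min ε 1) by have : 0 < min ε 1 := by positivity
                                   nlinarith)
  have ha1 : x.1 (Polynomial.X - Polynomial.C a) ≤ r * (1 + ε) :=
    ha.le.trans (by gcongr; exact min_le_left _ _)
  have ha2 : x.1 (Polynomial.X - Polynomial.C a) ≤ r * (1 + 1) :=
    ha.le.trans (by gcongr; exact min_le_right _ _)
  have h3 := norm_sub_le_seminorm_add x (a + ((m ^ k : ℕ) : K) * c) a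
  rw [add_sub_cancel_left, norm_mul, Nat.cast_pow, norm_pow] at h3
  have h4 := hkey a ha1
  rw [Nat.cast_pow] at h4
  rw [div_lt_iff₀ hc0] at hk
  linarith

theorem exists_tendsto_evalPoint (x : BerkA1 K) :
    ∃ u : Finset K × ℕ → K, Tendsto (fun i => evalPoint (u i)) (atTop ×ˢ atTop) (𝓝 x) := by
  have main : ∀ i : Finset K × ℕ, ∃ a : K, ∀ b ∈ i.1,
      |‖a - b‖ - x.1 (Polynomial.X - Polynomial.C b)| < 1 / ((i.2 : ℝ) + 1) := by
    intro i
    have hi : 0 < 1 / ((i.2 : ℝ) + 1) := by positivity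
    by_cases h : IsNonarchimedean fun a : K => ‖a‖
    · exact exists_seminorm_X_sub_C_approx h x i.1 hi
    · obtain ⟨a, ha⟩ := exists_seminorm_X_sub_C_lt h x hi
      refine ⟨a, fun b _ => lt_of_le_of_lt ?_ ha⟩
      have h1 := seminorm_X_sub_C_add_le x b a
      have h2 := norm_sub_le_seminorm_add x a b
      rw [norm_sub_rev] at h1
      rw [abs_le]; constructor <;> linarith
  choose u hu using main
  refine ⟨u, tendsto_berkA1_of_X_sub_C fun b => ?_⟩
  rw [tendsto_iff_dist_tendsto_zero]
  refine squeeze_zero' (Eventually.of_forall fun _ => dist_nonneg) ?_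
    (tendsto_one_div_add_atTop_nhds_zero_nat.comp tendsto_snd)
  filter_upwards [tendsto_fst.eventually (eventually_ge_atTop ({b} : Finset K))] with i hi
  have := (hu i b (hi (Finset.mem_singleton_self b))).le
  rw [Real.dist_eq]
  have e : (evalPoint (u i)).1 (Polynomial.X - Polynomial.C b) = ‖u i - b‖ := by
    change ‖Polynomial.eval _ _‖ = _
    simp
  rw [e]
  exact this

instance approach_neBot (x : BerkP1 K) : (approach x).NeBot := by
  classical
  refine comap_neBot_iff.2 fun t ht => ?_
  induction x using OnePoint.rec with
  | infty => exact ⟨OnePoint.infty, mem_of_mem_nhds ht⟩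
  | coe x =>
    obtain ⟨u, hu⟩ := exists_tendsto_evalPoint x
    have h1 : Tendsto (fun i => (OnePoint.some (evalPoint (u i)) : OnePoint (BerkA1 K)))
        (atTop ×ˢ atTop) (𝓝 (OnePoint.some x)) := (OnePoint.continuous_coe.tendsto x).comp hu
    obtain ⟨i, hi⟩ := (h1.eventually_mem ht).exists
    exact ⟨OnePoint.some (u i), hi⟩

end Density

section Extension

variable {K : Type*} [NontriviallyNormedField K] [IsAlgClosed K]

/-- A continuous function on `𝖯¹` is the extension of its restriction to `ℙ¹`. -/
theorem extend_eq_of_continuous {Y : Type*} [TopologicalSpace Y] [T2Space Y] [Nonempty Y]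
    {φ : OnePoint K → Y} {Ψ : BerkP1 K → Y} (hΨ : Continuous Ψ) (h : ∀ z, Ψ (incl z) = φ z) :
    extend φ = Ψ := by
  funext x
  refine Tendsto.limUnder_eq ?_
  have : φ = Ψ ∘ incl := funext fun z => (h z).symm
  rw [this]
  exact (hΨ.tendsto x).comp tendsto_comap

/-- Two continuous functions on `𝖯¹` that agree on `ℙ¹` are equal. -/
theorem eq_of_continuous_of_eq_on_incl {Y : Type*} [TopologicalSpace Y] [T2Space Y]
    {Ψ Ψ' : BerkP1 K → Y} (hΨ : Continuous Ψ) (hΨ' : Continuous Ψ')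
    (h : ∀ z, Ψ (incl z) = Ψ' (incl z)) (x : BerkP1 K) : Ψ x = Ψ' x := by
  have h1 : Tendsto (Ψ ∘ incl) (approach x) (𝓝 (Ψ x)) := (hΨ.tendsto x).comp tendsto_comap
  have h2 : Tendsto (Ψ' ∘ incl) (approach x) (𝓝 (Ψ' x)) := (hΨ'.tendsto x).comp tendsto_comap
  rw [show Ψ ∘ incl = Ψ' ∘ incl from funext h] at h1
  exact tendsto_nhds_unique h1 h2

theorem ge_of_ge_on_incl {Ψ : BerkP1 K → ℝ} (hΨ : Continuous Ψ) {c : ℝ}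
    (h : ∀ z, c ≤ Ψ (incl z)) (x : BerkP1 K) : c ≤ Ψ x :=
  ge_of_tendsto' ((hΨ.tendsto x).comp tendsto_comap : Tendsto (Ψ ∘ incl) (approach x) _) h

end Extension

/-! ### The norm on `K²` -/

section RealNorm

variable (K : Type*) [NormedField K]

open Classical in
/-- The norm on `ℝ²` that induces `vecNorm` on `K²`. -/
def pairNorm (a b : ℝ) : ℝ :=
  if IsNonarchimedean (fun a : K => ‖a‖) then max a b else Real.sqrt (a ^ 2 + b ^ 2)

theorem vecNorm_eq (p : K × K) : vecNorm p = pairNorm K ‖p.1‖ ‖p.2‖ := rfl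

theorem continuous_pairNorm : Continuous fun p : ℝ × ℝ => pairNorm K p.1 p.2 := by
  unfold pairNorm
  split_ifs <;> fun_prop

variable {a b : ℝ}

theorem max_le_pairNorm (a b : ℝ) : max a b ≤ pairNorm K a b := by
  unfold pairNorm
  split_ifs
  · exact le_rfl
  · exact max_le (Real.le_sqrt_of_sq_le (by nlinarith)) (Real.le_sqrt_of_sq_le (by nlinarith))

theorem pairNorm_le_add (ha : 0 ≤ a) (hb : 0 ≤ b) : pairNorm K a b ≤ a + b := by
  unfold pairNorm
  split_ifs
  · exact max_le (by linarith) (by linarith)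
  · exact Real.sqrt_le_iff.2 ⟨by positivity, by nlinarith [mul_nonneg ha hb]⟩

theorem pairNorm_mul {t : ℝ} (ht : 0 ≤ t) : pairNorm K (t * a) (t * b) = t * pairNorm K a b := by
  unfold pairNorm
  split_ifs
  · exact (mul_max_of_nonneg _ _ ht).symm
  · rw [mul_pow, mul_pow, ← mul_add, Real.sqrt_mul (sq_nonneg t), Real.sqrt_sq ht]

theorem pairNorm_one_pos (a : ℝ) : 0 < pairNorm K a 1 :=
  one_pos.trans_le ((le_max_right _ _).trans (max_le_pairNorm K a 1))

variable {K}

theorem vecNorm_pos {p : K × K} (hp : p ≠ 0) : 0 < vecNorm p := by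
  have h := max_le_pairNorm K ‖p.1‖ ‖p.2‖
  refine lt_of_lt_of_le (lt_max_iff.2 ?_) h
  by_contra! h0
  exact hp (Prod.ext (norm_le_zero_iff.1 h0.1) (norm_le_zero_iff.1 h0.2))

theorem vecNorm_smul (t : K) (p : K × K) : vecNorm (t • p) = ‖t‖ * vecNorm p := by
  simp only [vecNorm_eq, Prod.smul_fst, Prod.smul_snd, smul_eq_mul, norm_mul]
  exact pairNorm_mul K (norm_nonneg t)

theorem norm_wedge_le (p q : K × K) : ‖wedge p q‖ ≤ vecNorm p * vecNorm q := by
  unfold wedge vecNorm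
  split_ifs with h
  · have hs : ‖p.1 * q.2 - p.2 * q.1‖ ≤ max ‖p.1 * q.2‖ ‖p.2 * q.1‖ := by
      have := h (p.1 * q.2) (-(p.2 * q.1))
      simpa [sub_eq_add_neg] using this
    refine hs.trans (max_le ?_ ?_) <;> rw [norm_mul] <;> gcongr <;> simp
  · refine (norm_sub_le _ _).trans ?_
    rw [norm_mul, norm_mul, ← Real.sqrt_mul (by positivity)]
    refine Real.le_sqrt_of_sq_le ?_
    nlinarith [sq_nonneg (‖p.1‖ * ‖q.1‖ - ‖p.2‖ * ‖q.2‖)]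

theorem coords_ne_zero (z : OnePoint K) : coords z ≠ 0 := by
  induction z using OnePoint.rec with
  | infty => exact fun h => one_ne_zero (congrArg Prod.fst h)
  | coe z => exact fun h => one_ne_zero (congrArg Prod.snd h)

theorem coords_proj {p : K × K} (hp : p ≠ 0) : ∃ t : K, t ≠ 0 ∧ p = t • coords (proj p) := by
  unfold proj
  split_ifs with h
  · refine ⟨p.1, fun h1 => hp (Prod.ext h1 h), ?_⟩
    change p = p.1 • ((1, 0) : K × K)
    ext <;> simp [h]
  · refine ⟨p.2, h, ?_⟩
    change p = p.2 • ((p.1 / p.2, 1) : K × K)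
    ext <;> simp; field_simp

theorem proj_smul {t : K} (ht : t ≠ 0) (p : K × K) : proj (t • p) = proj p := by
  unfold proj
  have h : (t • p).2 = 0 ↔ p.2 = 0 := by simp [ht]
  by_cases hp : p.2 = 0
  · rw [if_pos hp, if_pos (h.2 hp)]
  · rw [if_neg hp, if_neg (mt h.1 hp), Prod.smul_fst, Prod.smul_snd, smul_eq_mul, smul_eq_mul,
      mul_div_mul_left _ _ ht]

theorem wedge_smul (s t : K) (p q : K × K) : wedge (s • p) (t • q) = s * t * wedge p q := by
  simp only [wedge, Prod.smul_fst, Prod.smul_snd, smul_eq_mul]; ring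

theorem chordal_proj {p q : K × K} (hp : p ≠ 0) (hq : q ≠ 0) :
    chordal (proj p) (proj q) = ‖wedge p q‖ / (vecNorm p * vecNorm q) := by
  obtain ⟨s, hs, hp'⟩ := coords_proj hp
  obtain ⟨t, ht, hq'⟩ := coords_proj hq
  have h1 := vecNorm_pos (coords_ne_zero (proj p))
  have h2 := vecNorm_pos (coords_ne_zero (proj q))
  have hs' := norm_pos_iff.2 hs
  have ht' := norm_pos_iff.2 ht
  unfold chordal
  conv_rhs => rw [hp', hq', wedge_smul, vecNorm_smul, vecNorm_smul, norm_mul, norm_mul]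
  field_simp

theorem proj_coords (z : OnePoint K) : proj (coords z) = z := by
  induction z using OnePoint.rec with
  | infty => simp [proj, coords]
  | coe z => simp [proj, coords]

theorem wedge_coords_ne_zero {z w : OnePoint K} (h : z ≠ w) :
    wedge (coords z) (coords w) ≠ 0 := by
  induction z using OnePoint.rec with
  | infty =>
    induction w using OnePoint.rec with
    | infty => exact absurd rfl h
    | coe w => change (1 : K) * 1 - 0 * w ≠ 0; simp
  | coe z =>
    induction w using OnePoint.rec with
    | infty => change z * 0 - (1 : K) * 1 ≠ 0; simp
    | coe w =>
      change z * 1 - 1 * w ≠ 0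
      rw [mul_one, one_mul, sub_ne_zero]
      exact fun hzw => h (congrArg _ hzw)

theorem chordal_self (z : OnePoint K) : chordal z z = 0 := by
  simp [chordal, wedge, mul_comm]

theorem chordal_comm (z w : OnePoint K) : chordal z w = chordal w z := by
  unfold chordal
  rw [mul_comm (vecNorm _), ← norm_neg]
  congr 2
  unfold wedge; ring

theorem chordal_nonneg (z w : OnePoint K) : 0 ≤ chordal z w := by
  have h1 := vecNorm_pos (coords_ne_zero z)
  have h2 := vecNorm_pos (coords_ne_zero w)
  unfold chordal; positivity

theorem chordal_le_one (z w : OnePoint K) : chordal z w ≤ 1 := by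
  have h1 := vecNorm_pos (coords_ne_zero z)
  have h2 := vecNorm_pos (coords_ne_zero w)
  exact (div_le_one (by positivity)).2 (norm_wedge_le _ _)

theorem chordal_pos {z w : OnePoint K} (h : z ≠ w) : 0 < chordal z w := by
  have h1 := vecNorm_pos (coords_ne_zero z)
  have h2 := vecNorm_pos (coords_ne_zero w)
  have h3 := norm_pos_iff.2 (wedge_coords_ne_zero h)
  unfold chordal; positivity

/-- A consequence of the Plücker relation. -/
theorem abs_chordal_mul_sub_le (w w' z r : OnePoint K) :
    |chordal w' z * chordal w r - chordal w' r * chordal w z| ≤ chordal w' w := by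
  have h1 := vecNorm_pos (coords_ne_zero z)
  have h2 := vecNorm_pos (coords_ne_zero w)
  have h3 := vecNorm_pos (coords_ne_zero w')
  have h4 := vecNorm_pos (coords_ne_zero r)
  refine le_trans ?_ (mul_le_of_le_one_right (chordal_nonneg w' w) (chordal_le_one z r))
  have e : ∀ a b c d : OnePoint K, chordal a b * chordal c d =
      ‖wedge (coords a) (coords b) * wedge (coords c) (coords d)‖ /
        (vecNorm (coords a) * vecNorm (coords b) * vecNorm (coords c) * vecNorm (coords d)) := by
    intro a b c d
    rw [norm_mul]; unfold chordal; rw [div_mul_div_comm, ← mul_assoc]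
  have hd1 : vecNorm (coords w') * vecNorm (coords r) * vecNorm (coords w) * vecNorm (coords z) =
    vecNorm (coords w') * vecNorm (coords z) * vecNorm (coords w) * vecNorm (coords r) := by ring
  have hd2 : vecNorm (coords w') * vecNorm (coords w) * vecNorm (coords z) * vecNorm (coords r) =
    vecNorm (coords w') * vecNorm (coords z) * vecNorm (coords w) * vecNorm (coords r) := by ring
  rw [e, e, e, hd1, hd2, ← sub_div, abs_div,
    abs_of_pos (show 0 < vecNorm (coords w') * vecNorm (coords z) * vecNorm (coords w) *
      vecNorm (coords r) by positivity)]
  gcongr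
  refine (abs_norm_sub_norm_le _ _).trans (le_of_eq (congrArg _ ?_))
  unfold wedge; ring

end RealNorm

/-! ### Homogeneous forms on `𝖯¹` -/

section HomNorm

variable {K : Type*} [NormedField K]

/-- The function `|P| / ‖·‖ ^ D` on `𝖯¹` attached to a homogeneous form of degree `D`, given by
its dehomogenization `P`. -/
def homNorm (D : ℕ) (P : K[X]) (x : BerkP1 K) : ℝ :=
  OnePoint.elim (x : OnePoint (BerkA1 K)) ‖P.coeff D‖
    fun y => y.1 P / pairNorm K (y.1 Polynomial.X) 1 ^ D

theorem homNorm_coe (D : ℕ) (P : K[X]) (x : BerkA1 K) :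
    homNorm D P (OnePoint.some x : OnePoint _) =
      x.1 P / pairNorm K (x.1 Polynomial.X) 1 ^ D := rfl

theorem homNorm_infty (D : ℕ) (P : K[X]) :
    homNorm D P (OnePoint.infty : OnePoint _) = ‖P.coeff D‖ := rfl

theorem homNorm_nonneg (D : ℕ) (P : K[X]) (x : BerkP1 K) : 0 ≤ homNorm D P x := by
  induction x using OnePoint.rec with
  | infty => exact norm_nonneg _
  | coe x =>
    rw [homNorm_coe]
    exact div_nonneg (apply_nonneg _ _) (pow_nonneg (pairNorm_one_pos K _).le _)

theorem homNorm_mul {D E : ℕ} {P Q : K[X]} (hP : P.natDegree ≤ D) (hQ : Q.natDegree ≤ E)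
    (x : BerkP1 K) : homNorm (D + E) (P * Q) x = homNorm D P x * homNorm E Q x := by
  induction x using OnePoint.rec with
  | infty =>
    rw [homNorm_infty, homNorm_infty, homNorm_infty,
      Polynomial.coeff_mul_add_eq_of_natDegree_le hP hQ, norm_mul]
  | coe x => rw [homNorm_coe, homNorm_coe, homNorm_coe, map_mul, pow_add, mul_div_mul_comm]

theorem homNorm_C (c : K) (x : BerkP1 K) : homNorm 0 (Polynomial.C c) x = ‖c‖ := by
  induction x using OnePoint.rec with
  | infty => simp [homNorm_infty]
  | coe x => simp [homNorm_coe, x.2]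

theorem homEval_finite {D : ℕ} {P : K[X]} (hP : P.natDegree ≤ D) (z : K) :
    homEval D P (z, 1) = P.eval z := by
  simp only [homEval, one_pow, mul_one]
  exact (Polynomial.eval_eq_sum_range' (Nat.lt_succ_of_le hP) z).symm

theorem homEval_infinite (D : ℕ) (P : K[X]) : homEval D P (1, 0) = P.coeff D := by
  simp only [homEval, one_pow, mul_one]
  rw [Finset.sum_range_succ, Finset.sum_eq_zero, Nat.sub_self, pow_zero, mul_one, zero_add]
  intro i hi
  rw [zero_pow (Nat.sub_ne_zero_of_lt (Finset.mem_range.1 hi)), mul_zero]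

theorem homEval_smul (D : ℕ) (P : K[X]) (t : K) (p : K × K) :
    homEval D P (t • p) = t ^ D * homEval D P p := by
  simp only [homEval, Finset.mul_sum, Prod.smul_fst, Prod.smul_snd, smul_eq_mul]
  refine Finset.sum_congr rfl fun i hi => ?_
  rw [← Nat.add_sub_cancel' (Nat.lt_succ_iff.1 (Finset.mem_range.1 hi)), pow_add]
  simp only [Nat.add_sub_cancel_left]
  ring

theorem homNorm_incl {D : ℕ} {P : K[X]} (hP : P.natDegree ≤ D) (z : OnePoint K) :
    homNorm D P (incl z) = ‖homEval D P (coords z)‖ / vecNorm (coords z) ^ D := by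
  induction z using OnePoint.rec with
  | infty =>
    change ‖P.coeff D‖ = ‖homEval D P (1, 0)‖ / pairNorm K ‖(1 : K)‖ ‖(0 : K)‖ ^ D
    rw [homEval_infinite]
    simp [pairNorm]
  | coe z =>
    change ‖P.eval z‖ / pairNorm K ‖Polynomial.X.eval z‖ 1 ^ D =
      ‖homEval D P (z, 1)‖ / pairNorm K ‖z‖ ‖(1 : K)‖ ^ D
    rw [homEval_finite hP, Polynomial.eval_X, norm_one]

theorem abs_seminorm_sub_le (x : BerkA1 K) (P Q : K[X]) : |x.1 P - x.1 Q| ≤ x.1 (P - Q) := by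
  have h1 := map_add_le_add x.1 (P - Q) Q
  have h2 := map_add_le_add x.1 (Q - P) P
  rw [sub_add_cancel] at h1 h2
  rw [map_sub_rev x.1 Q P] at h2
  rw [abs_le]; constructor <;> linarith

theorem continuous_homNorm {D : ℕ} {P : K[X]} (hP : P.natDegree ≤ D) :
    Continuous (homNorm D P) := by
  refine (OnePoint.continuous_iff _).2 ⟨?_, ?_⟩
  · change Tendsto (fun x : BerkA1 K => x.1 P / pairNorm K (x.1 Polynomial.X) 1 ^ D) _
      (𝓝 ‖P.coeff D‖)
    have hT := tendsto_seminorm_X_coclosedCompact (K := K)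
    have hinv := tendsto_inv_atTop_zero.comp hT
    have h1 : Tendsto (fun x : BerkA1 K => pairNorm K 1 (x.1 Polynomial.X)⁻¹ ^ D)
        (coclosedCompact _) (𝓝 1) := by
      have hc : Continuous fun t : ℝ => pairNorm K 1 t ^ D :=
        ((continuous_pairNorm K).comp (by fun_prop : Continuous fun t : ℝ => ((1 : ℝ), t))).pow D
      have := (hc.tendsto 0).comp hinv
      have e : pairNorm K 1 0 ^ D = 1 := by simp [pairNorm]
      rwa [e] at this
    have h2 : Tendsto (fun x : BerkA1 K => x.1 P * (x.1 Polynomial.X)⁻¹ ^ D)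
        (coclosedCompact _) (𝓝 ‖P.coeff D‖) := by
      rw [tendsto_iff_dist_tendsto_zero]
      have h3 : Tendsto (fun x : BerkA1 K => ∑ i ∈ Finset.range D,
          ‖P.coeff i‖ * (x.1 Polynomial.X)⁻¹ ^ (D - i)) (coclosedCompact _) (𝓝 0) := by
        have h4 : ∀ i ∈ Finset.range D, Tendsto (fun x : BerkA1 K =>
            ‖P.coeff i‖ * (x.1 Polynomial.X)⁻¹ ^ (D - i)) (coclosedCompact _) (𝓝 0) := by
          intro i hi
          have := (hinv.pow (D - i)).const_mul ‖P.coeff i‖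
          rwa [zero_pow (Nat.sub_ne_zero_of_lt (Finset.mem_range.1 hi)), mul_zero] at this
        simpa using tendsto_finsetSum _ h4
      refine squeeze_zero' (Eventually.of_forall fun _ => dist_nonneg) ?_ h3
      filter_upwards [hT.eventually (eventually_gt_atTop 0)] with x hx
      have e1 : P - Polynomial.C (P.coeff D) * Polynomial.X ^ D =
          ∑ i ∈ Finset.range D, Polynomial.C (P.coeff i) * Polynomial.X ^ i := by
        have := P.as_sum_range_C_mul_X_pow' (Nat.lt_succ_of_le hP)
        rw [Finset.sum_range_succ] at this
        exact sub_eq_of_eq_add this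
      have e2 : ‖P.coeff D‖ = x.1 (Polynomial.C (P.coeff D) * Polynomial.X ^ D) *
          (x.1 Polynomial.X)⁻¹ ^ D := by
        rw [map_mul, x.2, map_pow, mul_assoc, ← mul_pow, mul_inv_cancel₀ hx.ne', one_pow, mul_one]
      rw [Real.dist_eq, e2, ← sub_mul, abs_mul, abs_of_pos (show 0 < (x.1 Polynomial.X)⁻¹ ^ D by
        positivity)]
      refine (mul_le_mul_of_nonneg_right ((abs_seminorm_sub_le _ _ _).trans
        (e1 ▸ seminorm_sum_le x _ _)) (by positivity)).trans_eq ?_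
      rw [Finset.sum_mul]
      refine Finset.sum_congr rfl fun i hi => ?_
      rw [map_mul, x.2, map_pow, mul_assoc]
      congr 1
      conv_lhs => rw [← Nat.add_sub_cancel' (Finset.mem_range.1 hi).le, pow_add, ← mul_assoc,
        ← mul_pow, mul_inv_cancel₀ hx.ne', one_pow, one_mul]
    have h5 := h2.div h1 one_ne_zero
    rw [div_one] at h5
    refine h5.congr' ?_
    filter_upwards [hT.eventually (eventually_gt_atTop 0)] with x hx
    have e : pairNorm K (x.1 Polynomial.X) 1 =
        x.1 Polynomial.X * pairNorm K 1 (x.1 Polynomial.X)⁻¹ := by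
      rw [← pairNorm_mul K hx.le, mul_one, mul_inv_cancel₀ hx.ne']
    rw [Pi.div_apply, e, mul_pow, inv_pow]
    field_simp
  · refine (continuous_seminorm P).div (Continuous.pow ?_ D) fun x =>
      (pow_pos (pairNorm_one_pos K _) D).ne'
    exact (continuous_pairNorm K).comp ((continuous_seminorm Polynomial.X).prodMk continuous_const)

/-! ### The Hsia kernel with a classical argument -/

/-- The linear form vanishing at `w`. -/
def linForm (w : OnePoint K) : K[X] :=
  Polynomial.C (coords w).2 * Polynomial.X - Polynomial.C (coords w).1

theorem natDegree_linForm_le (w : OnePoint K) : (linForm w).natDegree ≤ 1 := by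
  unfold linForm; compute_degree

theorem homEval_linForm (w : OnePoint K) (p : K × K) :
    homEval 1 (linForm w) p = wedge p (coords w) := by
  simp [homEval, Finset.sum_range_succ, linForm, wedge, Polynomial.coeff_X]
  ring

/-- The chordal distance to a classical point, extended to `𝖯¹`. -/
def berkChordal (w : OnePoint K) (x : BerkP1 K) : ℝ :=
  homNorm 1 (linForm w) x / vecNorm (coords w)

theorem continuous_berkChordal (w : OnePoint K) : Continuous (berkChordal w) :=
  (continuous_homNorm (natDegree_linForm_le w)).div_const _

theorem berkChordal_incl (w z : OnePoint K) : berkChordal w (incl z) = chordal z w := by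
  rw [berkChordal, homNorm_incl (natDegree_linForm_le w), homEval_linForm, pow_one, div_div]
  rfl

theorem berkChordal_nonneg (w : OnePoint K) (x : BerkP1 K) : 0 ≤ berkChordal w x :=
  div_nonneg (homNorm_nonneg _ _ _) (vecNorm_pos (coords_ne_zero w)).le

theorem tendsto_berkChordal (w : OnePoint K) (x : BerkP1 K) :
    Tendsto (fun z => chordal z w) (approach x) (𝓝 (berkChordal w x)) := by
  have := ((continuous_berkChordal w).tendsto x).comp
    (tendsto_comap : Tendsto incl (approach x) (𝓝 x))
  refine this.congr fun z => berkChordal_incl w z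

end HomNorm

section Hsia

variable {K : Type*} [NontriviallyNormedField K] [IsAlgClosed K]

theorem berkChordal_le_one (w : OnePoint K) (x : BerkP1 K) : berkChordal w x ≤ 1 := by
  have := ge_of_ge_on_incl (continuous_berkChordal w).neg (c := -1) (fun z => by
    rw [Pi.neg_apply, berkChordal_incl]; exact neg_le_neg (chordal_le_one _ _)) x
  rw [Pi.neg_apply] at this
  linarith

theorem hsia_incl (w : OnePoint K) (x : BerkP1 K) : hsia (incl w) x = berkChordal w x := by
  obtain ⟨r, hr⟩ : ∃ r : OnePoint K, w ≠ r := by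
    obtain ⟨r, hr⟩ := exists_ne w
    exact ⟨r, hr.symm⟩
  have hwr : 0 < chordal w r := chordal_pos hr
  refine Tendsto.limsup_eq ?_
  set l := approach (incl w) ×ˢ approach x
  have h0 : Tendsto (fun p : OnePoint K × OnePoint K => chordal p.1 w) l (𝓝 0) := by
    have := (tendsto_berkChordal w (incl w)).comp (tendsto_fst : Tendsto _ l _)
    rwa [berkChordal_incl, chordal_self] at this
  have h1 : Tendsto (fun p : OnePoint K × OnePoint K => chordal p.1 r * chordal w p.2) l
      (𝓝 (chordal w r * berkChordal w x)) := by
    have e1 := (tendsto_berkChordal r (incl w)).comp (tendsto_fst : Tendsto _ l _)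
    have e2 := (tendsto_berkChordal w x).comp (tendsto_snd : Tendsto _ l _)
    rw [berkChordal_incl] at e1
    refine (e1.mul e2).congr fun p => ?_
    simp only [Function.comp_apply]
    rw [chordal_comm p.2 w]
  have h2 : Tendsto (fun p : OnePoint K × OnePoint K =>
      chordal p.1 p.2 * chordal w r - chordal p.1 r * chordal w p.2) l (𝓝 0) :=
    squeeze_zero_norm (fun p => abs_chordal_mul_sub_le w p.1 p.2 r) h0
  have h3 := (h2.add h1).div_const (chordal w r)
  rw [zero_add, mul_div_cancel_left₀ _ hwr.ne'] at h3
  refine h3.congr fun p => ?_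
  rw [sub_add_cancel, mul_div_cancel_right₀ _ hwr.ne']

end Hsia

/-! ### Composition of homogeneous forms and iteration of the lift -/

section Composition

variable {K : Type*} [NormedField K]

/-- The dehomogenization of `P(A, B)`, where `P` is a form of degree `D`. -/
def compHom (D : ℕ) (P A B : K[X]) : K[X] :=
  ∑ i ∈ Finset.range (D + 1), Polynomial.C (P.coeff i) * (A ^ i * B ^ (D - i))

theorem natDegree_compHom_le {D e : ℕ} (P : K[X]) {A B : K[X]} (hA : A.natDegree ≤ e)
    (hB : B.natDegree ≤ e) : (compHom D P A B).natDegree ≤ D * e := by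
  refine Polynomial.natDegree_sum_le_of_forall_le _ _ fun i hi => ?_
  refine (Polynomial.natDegree_C_mul_le _ _).trans (Polynomial.natDegree_mul_le.trans ?_)
  calc _ ≤ i * e + (D - i) * e := add_le_add (Polynomial.natDegree_pow_le_of_le i hA)
        (Polynomial.natDegree_pow_le_of_le (D - i) hB)
    _ = D * e := by
      rw [← add_mul, Nat.add_sub_cancel' (Nat.lt_succ_iff.1 (Finset.mem_range.1 hi))]

theorem homEval_compHom {D e : ℕ} (P : K[X]) {A B : K[X]} (hA : A.natDegree ≤ e)
    (hB : B.natDegree ≤ e) (z : OnePoint K) :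
    homEval (D * e) (compHom D P A B) (coords z) =
      homEval D P (homEval e A (coords z), homEval e B (coords z)) := by
  induction z using OnePoint.rec with
  | infty =>
    change homEval _ _ (1, 0) = homEval D P (homEval e A (1, 0), homEval e B (1, 0))
    rw [homEval_infinite, homEval_infinite, homEval_infinite, compHom, Polynomial.finsetSum_coeff,
      homEval]
    refine Finset.sum_congr rfl fun i hi => ?_
    have hi' : D * e = i * e + (D - i) * e := by
      rw [← add_mul, Nat.add_sub_cancel' (Nat.lt_succ_iff.1 (Finset.mem_range.1 hi))]
    rw [Polynomial.coeff_C_mul, hi', Polynomial.coeff_mul_add_eq_of_natDegree_le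
      (Polynomial.natDegree_pow_le_of_le i hA) (Polynomial.natDegree_pow_le_of_le (D - i) hB),
      Polynomial.coeff_pow_of_natDegree_le hA, Polynomial.coeff_pow_of_natDegree_le hB, mul_assoc]
  | coe z =>
    change homEval _ _ (z, 1) = homEval D P (homEval e A (z, 1), homEval e B (z, 1))
    rw [homEval_finite (natDegree_compHom_le P hA hB), homEval_finite hA, homEval_finite hB,
      compHom, Polynomial.eval_finsetSum, homEval]
    refine Finset.sum_congr rfl fun i _ => ?_
    simp [mul_assoc]

variable (f : RatFunc K)

theorem natDegree_num_le : f.num.natDegree ≤ ratDegree f := le_max_left _ _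

theorem natDegree_denom_le : f.denom.natDegree ≤ ratDegree f := le_max_right _ _

/-- The dehomogenized components of the `n`-th iterate of the lift of `f`. -/
def iterPair : ℕ → K[X] × K[X]
  | 0 => (Polynomial.X, 1)
  | n + 1 => (compHom (ratDegree f) f.num (iterPair n).1 (iterPair n).2,
      compHom (ratDegree f) f.denom (iterPair n).1 (iterPair n).2)

theorem natDegree_iterPair_le (n : ℕ) : (iterPair f n).1.natDegree ≤ ratDegree f ^ n ∧
    (iterPair f n).2.natDegree ≤ ratDegree f ^ n := by
  induction n with
  | zero => simp [iterPair]
  | succ n ih =>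
    rw [pow_succ']
    exact ⟨natDegree_compHom_le _ ih.1 ih.2, natDegree_compHom_le _ ih.1 ih.2⟩

theorem lift_iterate_coords (n : ℕ) (z : OnePoint K) : (lift f)^[n] (coords z) =
    (homEval (ratDegree f ^ n) (iterPair f n).1 (coords z),
      homEval (ratDegree f ^ n) (iterPair f n).2 (coords z)) := by
  induction n with
  | zero =>
    rw [Function.iterate_zero, id]
    ext <;> simp [iterPair, homEval, Polynomial.coeff_X, Polynomial.coeff_one]
  | succ n ih =>
    rw [Function.iterate_succ_apply', ih, pow_succ', lift]
    have h := natDegree_iterPair_le f n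
    rw [iterPair, homEval_compHom _ h.1 h.2, homEval_compHom _ h.1 h.2]

theorem lift_smul (t : K) (p : K × K) : lift f (t • p) = t ^ ratDegree f • lift f p := by
  simp only [lift, homEval_smul, Prod.smul_mk, smul_eq_mul]

/-- `‖F‖ / ‖·‖ ^ d` on `𝖯¹`. -/
def baseSize (x : BerkP1 K) : ℝ :=
  pairNorm K (homNorm (ratDegree f) f.num x) (homNorm (ratDegree f) f.denom x)

/-- `‖Fⁿ‖ / ‖·‖ ^ dⁿ` on `𝖯¹`. -/
def liftSize (n : ℕ) (x : BerkP1 K) : ℝ :=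
  pairNorm K (homNorm (ratDegree f ^ n) (iterPair f n).1 x)
    (homNorm (ratDegree f ^ n) (iterPair f n).2 x)

theorem continuous_baseSize : Continuous (baseSize f) :=
  (continuous_pairNorm K).comp ((continuous_homNorm (natDegree_num_le f)).prodMk
    (continuous_homNorm (natDegree_denom_le f)))

theorem continuous_liftSize (n : ℕ) : Continuous (liftSize f n) :=
  (continuous_pairNorm K).comp ((continuous_homNorm (natDegree_iterPair_le f n).1).prodMk
    (continuous_homNorm (natDegree_iterPair_le f n).2))

theorem pairNorm_homNorm_incl {D : ℕ} {A B : K[X]} (hA : A.natDegree ≤ D) (hB : B.natDegree ≤ D)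
    (z : OnePoint K) : pairNorm K (homNorm D A (incl z)) (homNorm D B (incl z)) =
      vecNorm (homEval D A (coords z), homEval D B (coords z)) / vecNorm (coords z) ^ D := by
  have := vecNorm_pos (coords_ne_zero z)
  rw [homNorm_incl hA, homNorm_incl hB, div_eq_inv_mul, div_eq_inv_mul,
    pairNorm_mul K (by positivity), ← div_eq_inv_mul]
  rfl

theorem baseSize_incl (z : OnePoint K) :
    baseSize f (incl z) = vecNorm (lift f (coords z)) / vecNorm (coords z) ^ ratDegree f :=
  pairNorm_homNorm_incl (natDegree_num_le f) (natDegree_denom_le f) z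

theorem liftSize_incl (n : ℕ) (z : OnePoint K) : liftSize f n (incl z) =
    vecNorm ((lift f)^[n] (coords z)) / vecNorm (coords z) ^ ratDegree f ^ n := by
  rw [lift_iterate_coords]
  exact pairNorm_homNorm_incl (natDegree_iterPair_le f n).1 (natDegree_iterPair_le f n).2 z

theorem baseSize_pos (x : BerkP1 K) : 0 < baseSize f x := by
  refine lt_of_lt_of_le ?_ (max_le_pairNorm K _ _)
  by_contra! h0
  have h1 := le_antisymm ((le_max_left _ _).trans h0) (homNorm_nonneg _ _ _)
  have h2 := le_antisymm ((le_max_right _ _).trans h0) (homNorm_nonneg _ _ _)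
  induction x using OnePoint.rec with
  | infty =>
    rw [homNorm_infty, norm_eq_zero] at h1 h2
    rcases le_total f.num.natDegree f.denom.natDegree with h | h
    · rw [ratDegree, max_eq_right h, Polynomial.coeff_natDegree,
        Polynomial.leadingCoeff_eq_zero] at h2
      exact f.denom_ne_zero h2
    · rw [ratDegree, max_eq_left h, Polynomial.coeff_natDegree,
        Polynomial.leadingCoeff_eq_zero] at h1
      rw [h1, Polynomial.natDegree_zero, Nat.le_zero] at h
      rw [ratDegree, h1, h, Polynomial.natDegree_zero, max_self] at h2
      have h3 := f.monic_denom.coeff_natDegree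
      rw [h, h2] at h3
      exact zero_ne_one h3
  | coe x =>
    have hp := pow_pos (pairNorm_one_pos K (x.1 Polynomial.X)) (ratDegree f)
    rw [homNorm_coe, div_eq_zero_iff, or_iff_left hp.ne'] at h1 h2
    obtain ⟨a, b, hab⟩ := f.isCoprime_num_denom
    have := map_add_le_add x.1 (a * f.num) (b * f.denom)
    rw [hab, map_one, map_mul, map_mul, h1, h2, mul_zero, mul_zero, add_zero] at this
    exact absurd this (not_le.2 one_pos)

theorem exists_baseSize_ge : ∃ c > 0, ∀ x, c ≤ baseSize f x := by
  obtain ⟨x₀, -, h₀⟩ := isCompact_univ.exists_isMinOn Set.univ_nonempty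
    (continuous_baseSize f).continuousOn
  exact ⟨_, baseSize_pos f x₀, fun x => h₀ (Set.mem_univ x)⟩

theorem vecNorm_lift {p : K × K} (hp : p ≠ 0) :
    vecNorm (lift f p) = baseSize f (incl (proj p)) * vecNorm p ^ ratDegree f := by
  obtain ⟨t, ht, h⟩ := coords_proj hp
  have h1 := vecNorm_pos (coords_ne_zero (proj p))
  conv_lhs => rw [h, lift_smul, vecNorm_smul]
  conv_rhs => rw [h, vecNorm_smul, proj_smul ht, proj_coords, baseSize_incl]
  rw [norm_pow, mul_pow]
  field_simp

theorem lift_ne_zero {p : K × K} (hp : p ≠ 0) : lift f p ≠ 0 := by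
  intro h0
  have h := vecNorm_lift f hp
  have h1 : 0 < baseSize f (incl (proj p)) * vecNorm p ^ ratDegree f :=
    mul_pos (baseSize_pos f _) (pow_pos (vecNorm_pos hp) _)
  rw [h0, vecNorm_eq] at h
  simp [pairNorm] at h
  rcases h with h | h
  · exact (baseSize_pos f _).ne' h
  · exact (vecNorm_pos hp).ne' h.1

theorem lift_iterate_ne_zero (n : ℕ) {p : K × K} (hp : p ≠ 0) : (lift f)^[n] p ≠ 0 := by
  induction n with
  | zero => exact hp
  | succ n ih => rw [Function.iterate_succ_apply']; exact lift_ne_zero f ih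

theorem ratMap_proj {p : K × K} (hp : p ≠ 0) : ratMap f (proj p) = proj (lift f p) := by
  obtain ⟨t, ht, h⟩ := coords_proj hp
  conv_rhs => rw [h, lift_smul, proj_smul (pow_ne_zero _ ht)]
  rfl

theorem ratMap_iterate (n : ℕ) (z : OnePoint K) :
    (ratMap f)^[n] z = proj ((lift f)^[n] (coords z)) := by
  induction n with
  | zero => exact (proj_coords z).symm
  | succ n ih =>
    rw [Function.iterate_succ_apply', Function.iterate_succ_apply', ih,
      ratMap_proj f (lift_iterate_ne_zero f n (coords_ne_zero z))]

theorem exists_liftSize_incl_ge (n : ℕ) : ∃ c > 0, ∀ z : OnePoint K, c ≤ liftSize f n (incl z) := by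
  obtain ⟨c, hc, hb⟩ := exists_baseSize_ge f
  induction n with
  | zero =>
    refine ⟨1, one_pos, fun z => ?_⟩
    have := vecNorm_pos (coords_ne_zero z)
    rw [liftSize_incl, pow_zero, pow_one, Function.iterate_zero, id, div_self this.ne']
  | succ n ih =>
    obtain ⟨c', hc', h'⟩ := ih
    refine ⟨c * c' ^ ratDegree f, by positivity, fun z => ?_⟩
    have h1 := vecNorm_pos (coords_ne_zero z)
    have h2 := h' z
    rw [liftSize_incl] at h2 ⊢
    rw [Function.iterate_succ_apply',
      vecNorm_lift f (lift_iterate_ne_zero f n (coords_ne_zero z)), pow_succ, pow_mul,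
      mul_div_assoc, ← div_pow]
    gcongr
    · exact (baseSize_pos f _).le
    · exact hb _

theorem log_liftSize_incl (n : ℕ) (z : OnePoint K) :
    Real.log (liftSize f n (incl z)) = liftHeight f n z := by
  have h1 := vecNorm_pos (coords_ne_zero z)
  have h2 := vecNorm_pos (lift_iterate_ne_zero f n (coords_ne_zero z))
  rw [liftSize_incl, Real.log_div h2.ne' (by positivity), Real.log_pow, liftHeight]
  push_cast
  rfl

theorem lift_iterate_smul (n : ℕ) (t : K) (p : K × K) :
    (lift f)^[n] (t • p) = t ^ ratDegree f ^ n • (lift f)^[n] p := by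
  induction n with
  | zero => simp
  | succ n ih =>
    rw [Function.iterate_succ_apply', ih, lift_smul, ← pow_mul, ← pow_succ,
      ← Function.iterate_succ_apply' (lift f)]

theorem liftHeight_proj (n : ℕ) {p : K × K} (hp : p ≠ 0) : liftHeight f n (proj p) =
    Real.log (vecNorm ((lift f)^[n] p)) - (ratDegree f : ℝ) ^ n * Real.log (vecNorm p) := by
  obtain ⟨t, ht, h⟩ := coords_proj hp
  have h1 := vecNorm_pos (coords_ne_zero (proj p))
  have h2 := vecNorm_pos (lift_iterate_ne_zero f n (coords_ne_zero (proj p)))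
  have ht' := norm_pos_iff.2 ht
  conv_rhs => rw [h, lift_iterate_smul, vecNorm_smul, vecNorm_smul, norm_pow,
    Real.log_mul (by positivity) h2.ne', Real.log_mul ht'.ne' h1.ne', Real.log_pow]
  rw [liftHeight]
  push_cast
  ring

theorem liftHeight_add (m n : ℕ) (z : OnePoint K) : liftHeight f (m + n) z =
    liftHeight f m ((ratMap f)^[n] z) + (ratDegree f : ℝ) ^ m * liftHeight f n z := by
  rw [ratMap_iterate, liftHeight_proj f m (lift_iterate_ne_zero f n (coords_ne_zero z)),
    liftHeight, liftHeight, Function.iterate_add_apply, pow_add]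
  ring

theorem homNorm_incl_ratMap {D : ℕ} {P : K[X]} (hP : P.natDegree ≤ D)
    (z : OnePoint K) : homNorm D P (incl (ratMap f z)) =
      homNorm (D * ratDegree f) (compHom D P f.num f.denom) (incl z) / baseSize f (incl z) ^ D := by
  have h0 := lift_ne_zero f (coords_ne_zero z)
  obtain ⟨t, ht, h⟩ := coords_proj h0
  have h1 := vecNorm_pos (coords_ne_zero z)
  have h2 := vecNorm_pos (coords_ne_zero (ratMap f z))
  have ht' := norm_pos_iff.2 ht
  change _ = t • coords (ratMap f z) at h
  rw [homNorm_incl hP, homNorm_incl (natDegree_compHom_le P (natDegree_num_le f)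
    (natDegree_denom_le f)), homEval_compHom P (natDegree_num_le f) (natDegree_denom_le f),
    baseSize_incl]
  change _ = ‖homEval D P (lift f (coords z))‖ / _ / _
  rw [h, homEval_smul, vecNorm_smul, norm_mul, norm_pow, div_pow, mul_pow, mul_comm D, pow_mul]
  field_simp

/-- The coordinates on `𝖯¹` given by all homogeneous forms. -/
def formCoords (x : BerkP1 K) (i : {i : ℕ × K[X] // i.2.natDegree ≤ i.1}) : ℝ :=
  homNorm i.1.1 i.1.2 x

theorem formCoords_injective : Function.Injective (formCoords (K := K)) := by
  have key : ∀ x y : BerkA1 K, formCoords (OnePoint.some x : OnePoint _) =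
      formCoords (OnePoint.some y : OnePoint _) → x = y := by
    intro x y h
    have hD : ∀ (D : ℕ) (P : K[X]), P.natDegree ≤ D → x.1 P / pairNorm K (x.1 Polynomial.X) 1 ^ D =
      y.1 P / pairNorm K (y.1 Polynomial.X) 1 ^ D := fun D P hP => congrFun h ⟨(D, P), hP⟩
    refine BerkA1.ext fun P => ?_
    have h1 := hD P.natDegree 1 (by simp)
    have h2 := hD P.natDegree P le_rfl
    rw [map_one, map_one] at h1
    have hx := pow_pos (pairNorm_one_pos K (x.1 Polynomial.X)) P.natDegree
    rw [div_eq_mul_one_div, h1, ← div_eq_mul_one_div] at h2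
    exact (div_left_inj' (pow_pos (pairNorm_one_pos K _) _).ne').1 h2
  have key' : ∀ x : BerkA1 K, formCoords (OnePoint.some x : OnePoint _) ≠
      formCoords (OnePoint.infty : OnePoint _) := by
    intro x h
    have h1 : x.1 (1 : K[X]) / pairNorm K (x.1 Polynomial.X) 1 ^ 1 = ‖(1 : K[X]).coeff 1‖ :=
      congrFun h ⟨(1, 1), by simp⟩
    rw [map_one, Polynomial.coeff_one, if_neg one_ne_zero, norm_zero] at h1
    exact (div_pos one_pos (pow_pos (pairNorm_one_pos K _) 1)).ne' h1
  intro x y h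
  induction x using OnePoint.rec with
  | infty =>
    induction y using OnePoint.rec with
    | infty => rfl
    | coe y => exact absurd h.symm (key' y)
  | coe x =>
    induction y using OnePoint.rec with
    | infty => exact absurd h (key' x)
    | coe y => exact congrArg _ (key x y h)

theorem isClosedEmbedding_formCoords : IsClosedEmbedding (formCoords (K := K)) :=
  Continuous.isClosedEmbedding (continuous_pi fun i => continuous_homNorm i.2) formCoords_injective

end Composition

section Dynamics

variable {K : Type*} [NontriviallyNormedField K] [IsAlgClosed K] (f : RatFunc K)

theorem liftSize_pos (n : ℕ) (x : BerkP1 K) : 0 < liftSize f n x := by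
  obtain ⟨c, hc, h⟩ := exists_liftSize_incl_ge f n
  exact hc.trans_le (ge_of_ge_on_incl (continuous_liftSize f n) h x)

theorem continuous_log_liftSize (n : ℕ) : Continuous fun x => Real.log (liftSize f n x) :=
  (continuous_liftSize f n).log fun x => (liftSize_pos f n x).ne'

theorem extend_liftHeight (n : ℕ) :
    extend (liftHeight f n) = fun x => Real.log (liftSize f n x) :=
  extend_eq_of_continuous (continuous_log_liftSize f n) (log_liftSize_incl f n)

variable {f}

theorem tendsto_liftHeight_div (hf : 1 < ratDegree f) (z : OnePoint K) :
    Tendsto (fun n : ℕ => liftHeight f n z / (ratDegree f : ℝ) ^ n) atTop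
      (𝓝 (liftGreen f (incl z))) := by
  have hd : (1 : ℝ) < ratDegree f := by exact_mod_cast hf
  have hd0 : (0 : ℝ) < ratDegree f := by linarith
  obtain ⟨B, hB⟩ := (isCompact_univ.image (continuous_log_liftSize f 1).abs).bddAbove
  have hB' : ∀ w : OnePoint K, |liftHeight f 1 w| ≤ B := fun w => by
    rw [← log_liftSize_incl]; exact hB ⟨_, Set.mem_univ _, rfl⟩
  have hcauchy : CauchySeq fun n : ℕ => liftHeight f n z / (ratDegree f : ℝ) ^ n := by
    refine cauchySeq_of_le_geometric (ratDegree f : ℝ)⁻¹ (B / ratDegree f)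
      (inv_lt_one_of_one_lt₀ hd) fun n => ?_
    rw [Real.dist_eq, abs_sub_comm, add_comm n 1, liftHeight_add f 1 n]
    have e : (liftHeight f 1 ((ratMap f)^[n] z) + (ratDegree f : ℝ) ^ 1 * liftHeight f n z) /
        (ratDegree f : ℝ) ^ (1 + n) - liftHeight f n z / (ratDegree f : ℝ) ^ n =
        liftHeight f 1 ((ratMap f)^[n] z) / (ratDegree f : ℝ) ^ (1 + n) := by
      rw [pow_add, pow_one]; field_simp; ring
    rw [e, abs_div, abs_of_pos (pow_pos hd0 _)]
    calc _ ≤ B / (ratDegree f : ℝ) ^ (1 + n) := by gcongr; exact hB' _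
      _ = _ := by rw [pow_add, pow_one, inv_pow]; field_simp
  have := hcauchy.tendsto_limUnder
  simp only [liftGreen, extend_liftHeight, log_liftSize_incl]
  exact this

/-- The functional equation of the Green function on classical points. -/
theorem liftHeight_eq (hf : 1 < ratDegree f) (n : ℕ) (z : OnePoint K) : liftHeight f n z =
    (ratDegree f : ℝ) ^ n * liftGreen f (incl z) - liftGreen f (incl ((ratMap f)^[n] z)) := by
  have hd0 : (0 : ℝ) < ratDegree f := by exact_mod_cast (zero_lt_one.trans hf)
  have h1 := ((tendsto_liftHeight_div hf z).comp (tendsto_add_atTop_nat n)).const_mul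
    ((ratDegree f : ℝ) ^ n)
  have h2 := (tendsto_liftHeight_div hf ((ratMap f)^[n] z)).add_const (liftHeight f n z)
  refine eq_sub_of_add_eq' (tendsto_nhds_unique h2 (h1.congr fun m => ?_))
  simp only [Function.comp_apply]
  rw [liftHeight_add, pow_add]
  field_simp

/-! ### Continuity of the extended map -/

theorem exists_continuous_berkMap (f : RatFunc K) :
    ∃ Ψ : BerkP1 K → BerkP1 K, Continuous Ψ ∧ ∀ z, Ψ (incl z) = incl (ratMap f z) := by
  set N : BerkP1 K → {i : ℕ × K[X] // i.2.natDegree ≤ i.1} → ℝ := fun x i =>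
    homNorm (i.1.1 * ratDegree f) (compHom i.1.1 i.1.2 f.num f.denom) x / baseSize f x ^ i.1.1
    with hN
  have hNc : Continuous N := continuous_pi fun i => (continuous_homNorm (natDegree_compHom_le _
    (natDegree_num_le f) (natDegree_denom_le f))).div ((continuous_baseSize f).pow _)
    fun x => (pow_pos (baseSize_pos f x) _).ne'
  have hNi : ∀ z, N (incl z) = formCoords (incl (ratMap f z)) := fun z => funext fun i =>
    (homNorm_incl_ratMap f i.2 z).symm
  have hmem : ∀ x, N x ∈ Set.range (formCoords (K := K)) := fun x =>
    isClosedEmbedding_formCoords.isClosed_range.mem_of_tendsto (b := approach x)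
      ((hNc.tendsto x).comp (tendsto_comap : Tendsto incl (approach x) _))
      (Eventually.of_forall fun z => ⟨_, (hNi z).symm⟩)
  choose Ψ hΨ using hmem
  refine ⟨Ψ, ?_, fun z => formCoords_injective ((hΨ _).trans (hNi z))⟩
  rw [isClosedEmbedding_formCoords.continuous_iff]
  exact hNc.congr fun x => (hΨ x).symm

theorem continuous_berkMap (f : RatFunc K) : Continuous (berkMap f) := by
  obtain ⟨Ψ, h1, h2⟩ := exists_continuous_berkMap f
  rw [berkMap, extend_eq_of_continuous h1 h2]
  exact h1

theorem berkMap_incl (f : RatFunc K) (z : OnePoint K) : berkMap f (incl z) = incl (ratMap f z) := by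
  obtain ⟨Ψ, h1, h2⟩ := exists_continuous_berkMap f
  rw [berkMap, extend_eq_of_continuous h1 h2, h2]

theorem berkMap_iterate_incl (f : RatFunc K) (n : ℕ) (z : OnePoint K) :
    (berkMap f)^[n] (incl z) = incl ((ratMap f)^[n] z) := by
  induction n with
  | zero => rfl
  | succ n ih => rw [Function.iterate_succ_apply', ih, berkMap_incl, Function.iterate_succ_apply']

/-- The functional equation of the Green function on `𝖯¹`. -/
theorem log_liftSize_eq (hf : 1 < ratDegree f) (hg : Continuous (liftGreen f)) (n : ℕ)
    (x : BerkP1 K) : Real.log (liftSize f n x) =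
      (ratDegree f : ℝ) ^ n * liftGreen f x - liftGreen f ((berkMap f)^[n] x) := by
  refine eq_of_continuous_of_eq_on_incl (continuous_log_liftSize f n)
    ((continuous_const.mul hg).sub (hg.comp ((continuous_berkMap f).iterate n))) (fun z => ?_) x
  rw [log_liftSize_incl, liftHeight_eq hf, ← berkMap_iterate_incl]
  rfl

end Dynamics

/-! ### Factorization of homogeneous forms -/

section Factorization

variable {K : Type*} [NormedField K]

theorem natDegree_prod_linForm_le (W : Multiset (OnePoint K)) :
    (W.map linForm).prod.natDegree ≤ W.card := by
  induction W using Multiset.induction_on with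
  | empty => simp
  | cons w W ih =>
    rw [Multiset.map_cons, Multiset.prod_cons, Multiset.card_cons, add_comm]
    exact Polynomial.natDegree_mul_le.trans (add_le_add (natDegree_linForm_le w) ih)

theorem homNorm_prod_linForm (W : Multiset (OnePoint K)) (x : BerkP1 K) :
    homNorm W.card (W.map linForm).prod x = (W.map fun w => homNorm 1 (linForm w) x).prod := by
  induction W using Multiset.induction_on with
  | empty => simpa using homNorm_C (1 : K) x
  | cons w W ih =>
    rw [Multiset.map_cons, Multiset.prod_cons, Multiset.card_cons, add_comm,
      homNorm_mul (natDegree_linForm_le w) (natDegree_prod_linForm_le W), ih, Multiset.map_cons,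
      Multiset.prod_cons]

theorem linForm_coe (b : K) : linForm (b : OnePoint K) = Polynomial.X - Polynomial.C b := by
  change Polynomial.C (1 : K) * Polynomial.X - Polynomial.C b = _
  simp

theorem linForm_infty : linForm (OnePoint.infty : OnePoint K) = -1 := by
  change Polynomial.C (0 : K) * Polynomial.X - Polynomial.C 1 = _
  simp

theorem exists_homNorm_eq_prod [IsAlgClosed K] {E : ℕ} {P : K[X]} (hP : P.natDegree ≤ E)
    (h0 : P ≠ 0) : ∃ W : Multiset (OnePoint K), W.card = E ∧ ∃ c : ℝ, 0 < c ∧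
      ∀ x, homNorm E P x = c * (W.map fun w => berkChordal w x).prod := by
  set W : Multiset (OnePoint K) := P.roots.map OnePoint.some +
    Multiset.replicate (E - P.natDegree) OnePoint.infty with hW
  have hcard : W.card = E := by
    rw [hW, Multiset.card_add, Multiset.card_map, Multiset.card_replicate,
      ← (IsAlgClosed.splits P).natDegree_eq_card_roots, Nat.add_sub_cancel' hP]
  have hprod : P = Polynomial.C (P.leadingCoeff * (-1) ^ (E - P.natDegree)) *
      (W.map linForm).prod := by
    rw [hW, Multiset.map_add, Multiset.prod_add, Multiset.map_replicate, Multiset.prod_replicate,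
      Multiset.map_map, linForm_infty]
    simp only [Function.comp_def, linForm_coe]
    conv_lhs => rw [(IsAlgClosed.splits P).eq_prod_roots]
    have h1 : ((-1 : K[X]) ^ (E - P.natDegree)) * (-1) ^ (E - P.natDegree) = 1 := by
      rw [← mul_pow]; simp
    rw [Polynomial.C_mul, Polynomial.C_pow, Polynomial.C_neg, Polynomial.C_1]
    linear_combination (-(Polynomial.C P.leadingCoeff *
      (P.roots.map fun b => Polynomial.X - Polynomial.C b).prod)) * h1
  have hlc : 0 < ‖P.leadingCoeff * (-1) ^ (E - P.natDegree)‖ := by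
    rw [norm_pos_iff]
    exact mul_ne_zero (Polynomial.leadingCoeff_ne_zero.2 h0) (pow_ne_zero _ (by simp))
  have hV : 0 < (W.map fun w => vecNorm (coords w)).prod :=
    Multiset.prod_pos (by simpa using fun w _ => vecNorm_pos (coords_ne_zero w))
  refine ⟨W, hcard, _, mul_pos hlc hV, fun x => ?_⟩
  have h1 := homNorm_mul (D := 0) (P := Polynomial.C (P.leadingCoeff * (-1) ^ (E - P.natDegree)))
    (Polynomial.natDegree_C _).le ((natDegree_prod_linForm_le W).trans hcard.le) x
  have h2 := homNorm_prod_linForm W x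
  rw [hcard] at h2
  rw [← hprod, zero_add, homNorm_C, h2] at h1
  rw [h1, mul_assoc, ← Multiset.prod_map_mul]
  congr 2
  refine Multiset.map_congr rfl fun w _ => ?_
  rw [berkChordal, mul_div_cancel₀ _ (vecNorm_pos (coords_ne_zero w)).ne']

/-- The weighted kernel `Φ_g(·, w) = log [·, w] - g - g(w)` with a classical point `w`. -/
def weightedKernel (g : BerkP1 K → ℝ) (w : OnePoint K) (x : BerkP1 K) : ℝ :=
  Real.log (berkChordal w x) - g x - g (incl w)

theorem weightedKernel_comm (g : BerkP1 K → ℝ) (z w : OnePoint K) :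
    weightedKernel g w (incl z) = weightedKernel g z (incl w) := by
  rw [weightedKernel, weightedKernel, berkChordal_incl, berkChordal_incl, chordal_comm]
  ring

theorem log_prod_berkChordal (g : BerkP1 K → ℝ) (W : Multiset (OnePoint K)) {x : BerkP1 K}
    (hx : ∀ w ∈ W, 0 < berkChordal w x) : Real.log (W.map fun w => berkChordal w x).prod =
      (W.map fun w => weightedKernel g w x).sum + W.card * g x +
        (W.map fun w => g (incl w)).sum := by
  induction W using Multiset.induction_on with
  | empty => simp
  | cons w W ih =>
    have h1 := hx w (Multiset.mem_cons_self w W)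
    have h2 : ∀ w' ∈ W, 0 < berkChordal w' x := fun w' h => hx w' (Multiset.mem_cons_of_mem h)
    have h3 : 0 < (W.map fun w => berkChordal w x).prod := Multiset.prod_pos (by simpa using h2)
    rw [Multiset.map_cons, Multiset.prod_cons, Real.log_mul h1.ne' h3.ne', ih h2,
      Multiset.map_cons, Multiset.map_cons, Multiset.sum_cons, Multiset.sum_cons,
      Multiset.card_cons, weightedKernel]
    push_cast
    ring

/-- The Riesz decomposition of `log |P|` for a homogeneous form `P`. -/
theorem exists_log_homNorm_eq [IsAlgClosed K] (g : BerkP1 K → ℝ) {E : ℕ} {P : K[X]}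
    (hP : P.natDegree ≤ E) (h0 : P ≠ 0) : ∃ W : Multiset (OnePoint K), W.card = E ∧ ∃ s : ℝ,
      (∀ x, 0 < homNorm E P x ↔ ∀ w ∈ W, 0 < berkChordal w x) ∧
      ∀ x, 0 < homNorm E P x → Real.log (homNorm E P x) - E * g x =
        (W.map fun w => weightedKernel g w x).sum + s := by
  obtain ⟨W, hW, c, hc, h⟩ := exists_homNorm_eq_prod hP h0
  have hiff : ∀ x, 0 < homNorm E P x ↔ ∀ w ∈ W, 0 < berkChordal w x := by
    intro x
    rw [h x]
    refine ⟨fun hpos w hw => (berkChordal_nonneg w x).lt_of_ne' fun h0 => ?_, fun hpos =>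
      mul_pos hc (Multiset.prod_pos (by simpa using hpos))⟩
    rw [Multiset.prod_eq_zero (Multiset.mem_map.2 ⟨w, hw, h0⟩), mul_zero] at hpos
    exact hpos.false
  refine ⟨W, hW, Real.log c + (W.map fun w => g (incl w)).sum, hiff, fun x hx => ?_⟩
  have hpos : 0 < (W.map fun w => berkChordal w x).prod :=
    Multiset.prod_pos (by simpa using (hiff x).1 hx)
  rw [h x, Real.log_mul hc.ne' hpos.ne', log_prod_berkChordal g W ((hiff x).1 hx), hW]
  ring

end Factorization

/-! ### Preimages and fixed points of iterates -/

section Decomposition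

variable {K : Type*} [NormedField K]

theorem homEval_sub (D : ℕ) (P Q : K[X]) (p : K × K) :
    homEval D (P - Q) p = homEval D P p - homEval D Q p := by
  simp only [homEval, Polynomial.coeff_sub, sub_mul, Finset.sum_sub_distrib]

theorem homEval_C_mul (D : ℕ) (a : K) (P : K[X]) (p : K × K) :
    homEval D (Polynomial.C a * P) p = a * homEval D P p := by
  simp only [homEval, Polynomial.coeff_C_mul, Finset.mul_sum, mul_assoc]

variable (f : RatFunc K) (n : ℕ)

/-- The form whose zeros are the preimages of `a` under `fⁿ`. -/
def preimageForm (a : OnePoint K) : K[X] :=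
  Polynomial.C (coords a).2 * (iterPair f n).1 - Polynomial.C (coords a).1 * (iterPair f n).2

theorem natDegree_preimageForm_le (a : OnePoint K) :
    (preimageForm f n a).natDegree ≤ ratDegree f ^ n :=
  (Polynomial.natDegree_sub_le _ _).trans (max_le
    ((Polynomial.natDegree_C_mul_le _ _).trans (natDegree_iterPair_le f n).1)
    ((Polynomial.natDegree_C_mul_le _ _).trans (natDegree_iterPair_le f n).2))

theorem homEval_preimageForm (a z : OnePoint K) :
    homEval (ratDegree f ^ n) (preimageForm f n a) (coords z) =
      wedge ((lift f)^[n] (coords z)) (coords a) := by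
  rw [preimageForm, homEval_sub, homEval_C_mul, homEval_C_mul, lift_iterate_coords, wedge]
  ring

/-- The form whose zeros are the fixed points of `fⁿ`. -/
def fixedForm : K[X] := (iterPair f n).1 - Polynomial.X * (iterPair f n).2

theorem natDegree_fixedForm_le : (fixedForm f n).natDegree ≤ ratDegree f ^ n + 1 := by
  refine (Polynomial.natDegree_sub_le _ _).trans (max_le
    ((natDegree_iterPair_le f n).1.trans (Nat.le_succ _)) ?_)
  refine Polynomial.natDegree_mul_le.trans ?_
  rw [add_comm]
  exact add_le_add (natDegree_iterPair_le f n).2 Polynomial.natDegree_X_le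

theorem homEval_fixedForm (z : OnePoint K) :
    homEval (ratDegree f ^ n + 1) (fixedForm f n) (coords z) =
      wedge ((lift f)^[n] (coords z)) (coords z) := by
  have h := natDegree_iterPair_le f n
  have h1 := natDegree_fixedForm_le f n
  rw [lift_iterate_coords]
  induction z using OnePoint.rec with
  | infty =>
    change homEval _ _ (1, 0) = homEval _ _ (1, 0) * 0 - homEval _ _ (1, 0) * 1
    rw [homEval_infinite, homEval_infinite, homEval_infinite, fixedForm, Polynomial.coeff_sub,
      Polynomial.coeff_X_mul, Polynomial.coeff_eq_zero_of_natDegree_lt (Nat.lt_succ_of_le h.1)]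
    ring
  | coe z =>
    change homEval _ _ (z, 1) = homEval _ _ (z, 1) * 1 - homEval _ _ (z, 1) * z
    rw [homEval_finite h1, homEval_finite h.1, homEval_finite h.2, fixedForm]
    simp; ring

theorem homNorm_fixedForm_incl (z : OnePoint K) :
    homNorm (ratDegree f ^ n + 1) (fixedForm f n) (incl z) =
      liftSize f n (incl z) * chordal ((ratMap f)^[n] z) z := by
  have h1 := vecNorm_pos (coords_ne_zero z)
  have h2 := lift_iterate_ne_zero f n (coords_ne_zero z)
  have h3 := vecNorm_pos h2
  have e := chordal_proj h2 (coords_ne_zero z)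
  rw [proj_coords] at e
  rw [homNorm_incl (natDegree_fixedForm_le f n), homEval_fixedForm, liftSize_incl, ratMap_iterate,
    e, pow_succ]
  field_simp

theorem homNorm_preimageForm_incl (a z : OnePoint K) :
    homNorm (ratDegree f ^ n) (preimageForm f n a) (incl z) =
      liftSize f n (incl z) * chordal ((ratMap f)^[n] z) a * vecNorm (coords a) := by
  have h1 := vecNorm_pos (coords_ne_zero z)
  have h2 := lift_iterate_ne_zero f n (coords_ne_zero z)
  have h3 := vecNorm_pos h2
  have h4 := vecNorm_pos (coords_ne_zero a)
  have e := chordal_proj h2 (coords_ne_zero a)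
  rw [proj_coords] at e
  rw [homNorm_incl (natDegree_preimageForm_le f n a), homEval_preimageForm, liftSize_incl,
    ratMap_iterate, e]
  field_simp

theorem fixedForm_ne_zero [IsAlgClosed K] (hD : 1 < ratDegree f ^ n) : fixedForm f n ≠ 0 := by
  intro h0
  have h := natDegree_iterPair_le f n
  have hA : (iterPair f n).1 = Polynomial.X * (iterPair f n).2 := sub_eq_zero.1 h0
  have hB : (iterPair f n).2.degree = 0 ∨ ∃ z, (iterPair f n).2.eval z = 0 := by
    by_cases hd : (iterPair f n).2.degree = 0
    · exact Or.inl hd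
    · exact Or.inr (IsAlgClosed.exists_root _ hd)
  rcases hB with hB | ⟨z, hz⟩
  · have hc := Polynomial.eq_C_of_degree_eq_zero hB
    refine lift_iterate_ne_zero f n (coords_ne_zero OnePoint.infty) ?_
    rw [lift_iterate_coords]
    change (homEval _ _ (1, 0), homEval _ _ (1, 0)) = _
    rw [homEval_infinite, homEval_infinite, hA, hc]
    obtain ⟨m, hm⟩ := Nat.exists_eq_add_of_lt hD
    rw [hm]
    ext
    · simp [Polynomial.coeff_C]
    · simp
  · refine lift_iterate_ne_zero f n (coords_ne_zero (z : OnePoint K)) ?_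
    rw [lift_iterate_coords]
    change (homEval _ _ (z, 1), homEval _ _ (z, 1)) = _
    rw [homEval_finite h.1, homEval_finite h.2, hA]
    simp [hz]

theorem preimageForm_ne_zero {a : OnePoint K} (ha : (ratMap f)^[n] a ≠ a) :
    preimageForm f n a ≠ 0 := by
  intro h0
  have h1 := wedge_coords_ne_zero ha
  have h2 := homEval_preimageForm f n a a
  rw [h0, show homEval (ratDegree f ^ n) (0 : K[X]) (coords a) = 0 by simp [homEval]] at h2
  have h3 := lift_iterate_ne_zero f n (coords_ne_zero a)
  obtain ⟨t, ht, h⟩ := coords_proj h3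
  rw [← ratMap_iterate] at h
  rw [h, ← one_smul K (coords a), wedge_smul] at h2
  exact mul_ne_zero (mul_ne_zero ht one_ne_zero) h1 h2.symm

end Decomposition

section DecompositionBerk

variable {K : Type*} [NontriviallyNormedField K] [IsAlgClosed K] (f : RatFunc K) (n : ℕ)

theorem prox_eq (x : BerkP1 K) :
    prox f n x = homNorm (ratDegree f ^ n + 1) (fixedForm f n) x / liftSize f n x := by
  refine congrFun (extend_eq_of_continuous (Ψ := fun x =>
    homNorm (ratDegree f ^ n + 1) (fixedForm f n) x / liftSize f n x)
    ((continuous_homNorm (natDegree_fixedForm_le f n)).div (continuous_liftSize f n)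
      fun x => (liftSize_pos f n x).ne') fun z => ?_) x
  rw [homNorm_fixedForm_incl, mul_div_cancel_left₀ _ (liftSize_pos f n _).ne']

theorem prox_incl (z : OnePoint K) : prox f n (incl z) = chordal ((ratMap f)^[n] z) z := by
  rw [prox_eq, homNorm_fixedForm_incl, mul_div_cancel_left₀ _ (liftSize_pos f n _).ne']

theorem homNorm_preimageForm (a : OnePoint K) (x : BerkP1 K) :
    homNorm (ratDegree f ^ n) (preimageForm f n a) x =
      liftSize f n x * berkChordal a ((berkMap f)^[n] x) * vecNorm (coords a) := by
  refine eq_of_continuous_of_eq_on_incl (continuous_homNorm (natDegree_preimageForm_le f n a))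
    (((continuous_liftSize f n).mul ((continuous_berkChordal a).comp
      ((continuous_berkMap f).iterate n))).mul continuous_const) (fun z => ?_) x
  rw [homNorm_preimageForm_incl]
  simp only [Pi.mul_apply, Function.comp_apply]
  rw [berkMap_iterate_incl, berkChordal_incl]

variable {f}

theorem exists_logProx_eq (hf : 1 < ratDegree f) (hg : Continuous (liftGreen f)) {n : ℕ}
    (hn : n ≠ 0) : ∃ W : Multiset (OnePoint K), W.card = ratDegree f ^ n + 1 ∧ ∃ s : ℝ,
      (∀ x, 0 < prox f n x ↔ ∀ w ∈ W, 0 < berkChordal w x) ∧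
      ∀ x, 0 < prox f n x → logProx f (liftGreen f) n x =
        (W.map fun w => weightedKernel (liftGreen f) w x).sum + s := by
  obtain ⟨W, hW, s, h1, h2⟩ := exists_log_homNorm_eq (liftGreen f) (natDegree_fixedForm_le f n)
    (fixedForm_ne_zero f n (Nat.one_lt_pow hn hf))
  have hpos : ∀ x, 0 < prox f n x ↔
      0 < homNorm (ratDegree f ^ n + 1) (fixedForm f n) x := fun x => by
    rw [prox_eq, div_pos_iff_of_pos_right (liftSize_pos f n x)]
  refine ⟨W, hW, s, fun x => (hpos x).trans (h1 x), fun x hx => ?_⟩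
  rw [← h2 x ((hpos x).1 hx), logProx, prox_eq, Real.log_div ((hpos x).1 hx).ne'
    (liftSize_pos f n x).ne', log_liftSize_eq hf hg]
  push_cast
  ring

theorem exists_weightedKernel_iterate_eq (hf : 1 < ratDegree f) (hg : Continuous (liftGreen f))
    (n : ℕ) {a : OnePoint K} (ha : (ratMap f)^[n] a ≠ a) :
    ∃ W : Multiset (OnePoint K), W.card = ratDegree f ^ n ∧ ∃ s : ℝ,
      (∀ x, 0 < berkChordal a ((berkMap f)^[n] x) ↔ ∀ w ∈ W, 0 < berkChordal w x) ∧
      ∀ x, 0 < berkChordal a ((berkMap f)^[n] x) →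
        weightedKernel (liftGreen f) a ((berkMap f)^[n] x) =
          (W.map fun w => weightedKernel (liftGreen f) w x).sum + s := by
  obtain ⟨W, hW, s, h1, h2⟩ := exists_log_homNorm_eq (liftGreen f)
    (natDegree_preimageForm_le f n a) (preimageForm_ne_zero f n ha)
  have hv := vecNorm_pos (coords_ne_zero a)
  have hpos : ∀ x, 0 < berkChordal a ((berkMap f)^[n] x) ↔
      0 < homNorm (ratDegree f ^ n) (preimageForm f n a) x := fun x => by
    rw [homNorm_preimageForm, mul_pos_iff_of_pos_right hv,
      mul_pos_iff_of_pos_left (liftSize_pos f n x)]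
  refine ⟨W, hW, s - Real.log (vecNorm (coords a)) - liftGreen f (incl a),
    fun x => (hpos x).trans (h1 x), fun x hx => ?_⟩
  have h3 := h2 x ((hpos x).1 hx)
  rw [homNorm_preimageForm, Real.log_mul (mul_pos (liftSize_pos f n x) hx).ne' hv.ne',
    Real.log_mul (liftSize_pos f n x).ne' hx.ne', log_liftSize_eq hf hg] at h3
  rw [weightedKernel]
  push_cast at h3
  linarith

end DecompositionBerk

/-- If the fixed points `Q` and the fibre `B` over a non-fixed point `a` both decompose a symmetric
kernel, then the two additive constants determine each other. -/
theorem constant_relation {Z : Type*} {F : Z → Z} {φ : Z → Z → ℝ} (hφ : ∀ z w, φ z w = φ w z)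
    {a : Z} (ha : F a ≠ a) {B Q : Multiset Z} {D : ℕ} (hB : B.card = D) (hQ : Q.card = D + 1)
    {s t : ℝ} (hB0 : ∀ b ∈ B, F b = a) (hQ0 : ∀ q ∈ Q, F q = q)
    (h1 : ∀ z, F z ≠ a → φ (F z) a = (B.map fun b => φ z b).sum + s)
    (h2 : ∀ z, F z ≠ z → φ (F z) z = (Q.map fun q => φ z q).sum + t) :
    ((D : ℝ) - 1) * t = D * s := by
  have e1 := h1 a ha
  have e2 := h2 a ha
  have e3 : (B.map fun b => φ a b).sum =
      (B.map fun b => (Q.map fun q => φ b q).sum).sum + D * t := by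
    rw [← hB, ← nsmul_eq_mul, ← Multiset.sum_replicate, ← Multiset.map_const',
      ← Multiset.sum_map_add]
    refine congrArg _ (Multiset.map_congr rfl fun b hb => ?_)
    have hb' : F b ≠ b := fun h => ha ((h.symm.trans (hB0 b hb)) ▸ h)
    rw [← h2 b hb', hB0 b hb]
  have e4 : (Q.map fun q => φ a q).sum =
      (Q.map fun q => (B.map fun b => φ b q).sum).sum + ((D + 1 : ℕ) : ℝ) * s := by
    rw [← hQ, ← nsmul_eq_mul, ← Multiset.sum_replicate, ← Multiset.map_const',
      ← Multiset.sum_map_add]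
    refine congrArg _ (Multiset.map_congr rfl fun q hq => ?_)
    have hq' : F q ≠ a := fun h => ha (by rw [← h, hQ0 q hq, hQ0 q hq])
    have := h1 q hq'
    rw [hQ0 q hq] at this
    rw [hφ a q, this]
    simp only [hφ q]
  rw [Multiset.sum_map_sum_map] at e3
  push_cast at e4
  linarith

/-! ### Logarithmic potentials at classical points -/

section Potential

variable {K : Type*} [NontriviallyNormedField K] [IsAlgClosed K]

theorem negLogHsia_of_pos {w : OnePoint K} {x : BerkP1 K} (h : 0 < berkChordal w x) :
    negLogHsia (incl w) x = ENNReal.ofReal (-Real.log (berkChordal w x)) := by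
  rw [negLogHsia, hsia_incl, ENNReal.log_ofReal_of_pos h, ← EReal.coe_neg,
    EReal.real_coe_toENNReal]

theorem negLogHsia_of_eq_zero {w : OnePoint K} {x : BerkP1 K} (h : berkChordal w x = 0) :
    negLogHsia (incl w) x = ⊤ := by
  rw [negLogHsia, hsia_incl, h, ENNReal.ofReal_zero, ENNReal.log_zero, EReal.neg_bot,
    EReal.toENNReal_top]

theorem negLogHsia_incl_self (w : OnePoint K) : negLogHsia (incl w) (incl w) = ⊤ :=
  negLogHsia_of_eq_zero (by rw [berkChordal_incl, chordal_self])

theorem measurable_negLogHsia (w : OnePoint K) : Measurable (negLogHsia (incl w)) := by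
  have hm := (continuous_berkChordal w).measurable
  have h : negLogHsia (incl w) = fun x => if berkChordal w x = 0 then ⊤ else
      ENNReal.ofReal (-Real.log (berkChordal w x)) := by
    funext x
    split_ifs with h0
    · exact negLogHsia_of_eq_zero h0
    · exact negLogHsia_of_pos ((berkChordal_nonneg w x).lt_of_ne' h0)
  rw [h]
  exact Measurable.ite (hm (measurableSet_singleton 0)) measurable_const
    (Real.measurable_log.comp hm).neg.ennreal_ofReal

theorem integrable_log_berkChordal {σ : Measure (BerkP1 K)} {w : OnePoint K}
    (h : ∫⁻ x, negLogHsia (incl w) x ∂σ ≠ ⊤) :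
    (∀ᵐ x ∂σ, 0 < berkChordal w x) ∧ Integrable (fun x => Real.log (berkChordal w x)) σ ∧
      ∫ x, Real.log (berkChordal w x) ∂σ = -(∫⁻ x, negLogHsia (incl w) x ∂σ).toReal := by
  have hm := measurable_negLogHsia w
  have hlt := ae_lt_top hm h
  have hpos : ∀ᵐ x ∂σ, 0 < berkChordal w x := by
    filter_upwards [hlt] with x hx
    refine (berkChordal_nonneg w x).lt_of_ne' fun h0 => ?_
    rw [negLogHsia_of_eq_zero h0] at hx
    exact hx.false
  have heq : (fun x => -(negLogHsia (incl w) x).toReal) =ᵐ[σ]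
      fun x => Real.log (berkChordal w x) := by
    filter_upwards [hpos] with x hx
    rw [negLogHsia_of_pos hx, ENNReal.toReal_ofReal, neg_neg]
    exact neg_nonneg.2 (Real.log_nonpos hx.le (berkChordal_le_one w x))
  refine ⟨hpos, (integrable_toReal_of_lintegral_ne_top hm.aemeasurable h).neg.congr heq, ?_⟩
  rw [← integral_congr_ae heq, integral_neg, integral_toReal hm.aemeasurable hlt]

end Potential

/-! ### Points of bounded potential -/

section BoundedPotential

variable {K : Type*} [NontriviallyNormedField K]

/-- The open Berkovich disc with centre `a` and radius `r`. -/
def openDisc (a : K) (r : ℝ) : Set (BerkP1 K) :=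
  (OnePoint.some '' {x : BerkA1 K | x.1 (Polynomial.X - Polynomial.C a) < r} :
    Set (OnePoint (BerkA1 K)))

theorem measurableSet_openDisc (a : K) (r : ℝ) : MeasurableSet (openDisc a r) :=
  (show IsOpen (openDisc a r) from OnePoint.isOpen_image_coe.2
    (isOpen_lt (continuous_seminorm _) continuous_const)).measurableSet

theorem openDisc_subset {a b : K} {r s : ℝ} (h : r + ‖b - a‖ ≤ s) : openDisc a r ⊆ openDisc b s := by
  rintro _ ⟨x, hx, rfl⟩
  exact ⟨x, (seminorm_X_sub_C_add_le x b a).trans_lt ((add_lt_add_left hx _).trans_le h), rfl⟩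

theorem disjoint_openDisc {a b : K} {r : ℝ} (h : 2 * r ≤ ‖a - b‖) :
    Disjoint (openDisc a r) (openDisc b r) := by
  rw [Set.disjoint_left]
  rintro _ ⟨x, hx, rfl⟩ ⟨y, hy, hxy⟩
  obtain rfl : y = x := OnePoint.coe_injective hxy
  have h1 := norm_sub_le_seminorm_add y a b
  have hx' : y.1 (Polynomial.X - Polynomial.C a) < r := hx
  have hy' : y.1 (Polynomial.X - Polynomial.C b) < r := hy
  linarith

theorem exists_half_measure_disc (σ : Measure (BerkP1 K)) {t : K} (ht0 : 0 < ‖t‖) (ht : ‖t‖ < 1 / 6)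
    (i : ℕ) (a : K) : ∃ a', ‖a - a'‖ ≤ ‖t‖ ^ i ∧
      2 * σ (openDisc a' (3 * ‖t‖ ^ (i + 1))) ≤ σ (openDisc a (3 * ‖t‖ ^ i)) := by
  have hq : 0 < ‖t‖ ^ i := by positivity
  have h1 : openDisc a (3 * ‖t‖ ^ (i + 1)) ⊆ openDisc a (3 * ‖t‖ ^ i) :=
    openDisc_subset (by rw [sub_self, norm_zero, pow_succ]; nlinarith)
  have h2 : openDisc (a + t ^ i) (3 * ‖t‖ ^ (i + 1)) ⊆ openDisc a (3 * ‖t‖ ^ i) :=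
    openDisc_subset (by
      rw [sub_add_cancel_left, norm_neg, norm_pow, pow_succ]; nlinarith)
  have h3 : Disjoint (openDisc a (3 * ‖t‖ ^ (i + 1))) (openDisc (a + t ^ i) (3 * ‖t‖ ^ (i + 1))) :=
    disjoint_openDisc (by
      rw [sub_add_cancel_left, norm_neg, norm_pow, pow_succ]; nlinarith)
  have h4 : σ (openDisc a (3 * ‖t‖ ^ (i + 1))) + σ (openDisc (a + t ^ i) (3 * ‖t‖ ^ (i + 1))) ≤
      σ (openDisc a (3 * ‖t‖ ^ i)) := by
    rw [← measure_union h3 (measurableSet_openDisc _ _)]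
    exact measure_mono (Set.union_subset h1 h2)
  rcases le_total (σ (openDisc a (3 * ‖t‖ ^ (i + 1))))
    (σ (openDisc (a + t ^ i) (3 * ‖t‖ ^ (i + 1)))) with h | h
  · refine ⟨a, by simp, le_trans ?_ h4⟩
    rw [two_mul]; gcongr
  · refine ⟨a + t ^ i, by rw [sub_add_cancel_left, norm_neg, norm_pow], le_trans ?_ h4⟩
    rw [two_mul]; gcongr

theorem exists_center_small_discs [CompleteSpace K] (σ : Measure (BerkP1 K)) {t : K}
    (ht0 : 0 < ‖t‖) (ht : ‖t‖ < 1 / 6) :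
    ∃ a : K, ‖a‖ ≤ 2 ∧ ∀ i : ℕ, σ (openDisc a (‖t‖ ^ i)) ≤ 2⁻¹ ^ i * σ Set.univ := by
  choose next hnext1 hnext2 using exists_half_measure_disc σ ht0 ht
  set u : ℕ → K := fun i => Nat.rec 0 (fun i a => next i a) i with hu
  have husucc : ∀ i, u (i + 1) = next i (u i) := fun i => rfl
  have hdist : ∀ i, dist (u i) (u (i + 1)) ≤ 1 * ‖t‖ ^ i := fun i => by
    rw [dist_eq_norm, one_mul, husucc]; exact hnext1 i (u i)
  obtain ⟨a, ha⟩ := cauchySeq_tendsto_of_complete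
    (cauchySeq_of_le_geometric ‖t‖ 1 (by linarith) hdist)
  have hda : ∀ i, dist (u i) a ≤ 2 * ‖t‖ ^ i := fun i => by
    refine (dist_le_of_le_geometric_of_tendsto ‖t‖ 1 (by linarith) hdist ha i).trans ?_
    rw [one_mul, div_le_iff₀ (by linarith)]
    have : 0 < ‖t‖ ^ i := by positivity
    nlinarith
  have hmeas : ∀ i, σ (openDisc (u i) (3 * ‖t‖ ^ i)) ≤ 2⁻¹ ^ i * σ Set.univ := by
    intro i
    induction i with
    | zero => simpa using measure_mono (Set.subset_univ _)
    | succ i ih =>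
      have h1 := (hnext2 i (u i)).trans ih
      rw [← husucc] at h1
      calc _ = 2⁻¹ * (2 * σ (openDisc (u (i + 1)) (3 * ‖t‖ ^ (i + 1)))) := by
            rw [← mul_assoc, ENNReal.inv_mul_cancel two_ne_zero ENNReal.ofNat_ne_top, one_mul]
        _ ≤ 2⁻¹ * (2⁻¹ ^ i * σ Set.univ) := by gcongr
        _ = _ := by rw [pow_succ', mul_assoc]
  refine ⟨a, ?_, fun i => (measure_mono (openDisc_subset ?_)).trans (hmeas i)⟩
  · have := hda 0
    simpa [hu, dist_eq_norm] using this
  · have := hda i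
    rw [dist_eq_norm] at this
    linarith

theorem berkChordal_coe_ge {a : K} (ha : ‖a‖ ≤ 2) (x : BerkA1 K) :
    x.1 (Polynomial.X - Polynomial.C a) / (3 * (x.1 (Polynomial.X - Polynomial.C a) + 3)) ≤
      berkChordal (a : OnePoint K) (OnePoint.some x : OnePoint _) := by
  have h1 : x.1 Polynomial.X ≤ x.1 (Polynomial.X - Polynomial.C a) + 2 := by
    have := seminorm_X_sub_C_add_le x 0 a
    rw [Polynomial.C_0, sub_zero, zero_sub, norm_neg] at this
    linarith
  have h2 : vecNorm (coords (a : OnePoint K)) ≤ 3 := by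
    refine (pairNorm_le_add K (norm_nonneg a) (norm_nonneg (1 : K))).trans ?_
    rw [norm_one]; linarith
  have h3 := pairNorm_le_add K (apply_nonneg x.1 Polynomial.X) zero_le_one
  have h4 := vecNorm_pos (coords_ne_zero (a : OnePoint K))
  have h5 := pairNorm_one_pos K (x.1 Polynomial.X)
  have h6 := apply_nonneg x.1 (Polynomial.X - Polynomial.C a)
  have e : berkChordal (a : OnePoint K) (OnePoint.some x : OnePoint _) =
      x.1 (linForm (a : OnePoint K)) / pairNorm K (x.1 Polynomial.X) 1 ^ 1 /
        vecNorm (coords (a : OnePoint K)) := rfl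
  rw [e, linForm_coe, pow_one, div_div, mul_comm (3 : ℝ)]
  gcongr
  linarith

theorem berkChordal_infty_ge {a : K} (ha : ‖a‖ ≤ 2) :
    1 / 3 ≤ berkChordal (a : OnePoint K) (OnePoint.infty : OnePoint _) := by
  have h2 : vecNorm (coords (a : OnePoint K)) ≤ 3 := by
    refine (pairNorm_le_add K (norm_nonneg a) (norm_nonneg (1 : K))).trans ?_
    rw [norm_one]; linarith
  have h4 := vecNorm_pos (coords_ne_zero (a : OnePoint K))
  have e' : berkChordal (a : OnePoint K) (OnePoint.infty : OnePoint _) =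
      ‖(linForm (a : OnePoint K)).coeff 1‖ / vecNorm (coords (a : OnePoint K)) := rfl
  rw [e', linForm_coe]
  have e : ‖(Polynomial.X - Polynomial.C a : K[X]).coeff 1‖ = 1 := by
    simp
  rw [e]
  gcongr

variable [IsAlgClosed K]

theorem negLogHsia_le_tsum {t : K} (ht0 : 0 < ‖t‖) (ht : ‖t‖ < 1 / 6) {a : K} (ha : ‖a‖ ≤ 2)
    (y : BerkP1 K) : negLogHsia (incl (a : OnePoint K)) y ≤
      ENNReal.ofReal (Real.log 12 - Real.log ‖t‖) +
        ∑' i : ℕ, (openDisc a (‖t‖ ^ i)).indicator (fun _ => ENNReal.ofReal (-Real.log ‖t‖)) y := by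
  have hL : 0 < -Real.log ‖t‖ := neg_pos.2 (Real.log_neg ht0 (by linarith))
  have h12 : 0 ≤ Real.log 12 := Real.log_nonneg (by norm_num)
  induction y using OnePoint.rec with
  | infty =>
    refine le_trans ?_ le_self_add
    have h := berkChordal_infty_ge ha
    have h0 : 0 < berkChordal (a : OnePoint K) (OnePoint.infty : OnePoint _) := by linarith
    rw [negLogHsia_of_pos h0]
    refine ENNReal.ofReal_le_ofReal ?_
    have h2 := Real.log_le_log (by norm_num) h
    rw [one_div, Real.log_inv] at h2
    have h3 : Real.log 3 ≤ Real.log 12 := Real.log_le_log (by norm_num) (by norm_num)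
    linarith
  | coe x =>
    have hge := berkChordal_coe_ge ha x
    set v := x.1 (Polynomial.X - Polynomial.C a) with hv
    have hmem : ∀ i : ℕ, v < ‖t‖ ^ i → (openDisc a (‖t‖ ^ i)).indicator
        (fun _ => ENNReal.ofReal (-Real.log ‖t‖)) (OnePoint.some x : OnePoint (BerkA1 K)) =
        ENNReal.ofReal (-Real.log ‖t‖) := fun i hi => Set.indicator_of_mem
      (show (OnePoint.some x : OnePoint (BerkA1 K)) ∈ openDisc a (‖t‖ ^ i) from ⟨x, hi, rfl⟩)
      (fun _ => ENNReal.ofReal (-Real.log ‖t‖))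
    rcases (apply_nonneg x.1 (Polynomial.X - Polynomial.C a)).eq_or_lt with h0 | h0
    · have := fun i : ℕ => hmem i (by rw [hv, ← h0]; positivity)
      simp only [this]
      rw [ENNReal.tsum_const_eq_top_of_ne_zero (by simpa using hL), add_top]
      exact le_top
    · have hb : 0 < v / (3 * (v + 3)) := by positivity
      have hlog : -Real.log (berkChordal (a : OnePoint K) (OnePoint.some x : OnePoint _)) ≤
          Real.log 3 + Real.log (v + 3) - Real.log v := by
        have := Real.log_le_log hb hge
        rw [Real.log_div h0.ne' (by positivity), Real.log_mul (by norm_num) (by positivity)] at this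
        linarith
      have h34 : Real.log 12 = Real.log 3 + Real.log 4 := by
        rw [← Real.log_mul (by norm_num) (by norm_num)]; norm_num
      rw [negLogHsia_of_pos (hb.trans_le hge)]
      rcases le_total 1 v with h1 | h1
      · refine le_trans (ENNReal.ofReal_le_ofReal ?_) le_self_add
        have : Real.log (v + 3) ≤ Real.log (4 * v) := Real.log_le_log (by positivity) (by linarith)
        rw [Real.log_mul (by norm_num) h0.ne'] at this
        linarith
      · obtain ⟨k, hk1, hk2⟩ := exists_nat_pow_near_of_lt_one h0 h1 ht0 (by linarith)
        have hsum : (k : ℝ≥0∞) * ENNReal.ofReal (-Real.log ‖t‖) ≤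
            ∑' i : ℕ, (openDisc a (‖t‖ ^ i)).indicator (fun _ => ENNReal.ofReal (-Real.log ‖t‖))
              (OnePoint.some x : OnePoint (BerkA1 K)) := by
          refine le_trans (le_of_eq ?_) (ENNReal.sum_le_tsum (Finset.range k))
          refine Eq.trans (b := ∑ _i ∈ Finset.range k, ENNReal.ofReal (-Real.log ‖t‖)) (by simp)
            (Finset.sum_congr rfl fun i hi => (hmem i (hk2.trans_lt
              (pow_lt_pow_right_of_lt_one₀ ht0 (by linarith) (Finset.mem_range.1 hi)))).symm)
        refine le_trans ?_ (add_le_add le_rfl hsum)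
        rw [← ENNReal.ofReal_natCast, ← ENNReal.ofReal_mul (by positivity),
          ← ENNReal.ofReal_add (by linarith) (by positivity)]
        refine ENNReal.ofReal_le_ofReal ?_
        have h2 := Real.log_le_log (by positivity) hk1.le
        rw [Real.log_pow] at h2
        push_cast at h2
        have h3 : Real.log (v + 3) ≤ Real.log 4 := Real.log_le_log (by positivity) (by linarith)
        linarith

variable (K)

/-- There is a uniform bound for the minimum over `ℙ¹` of the potential of a measure. -/
theorem exists_lintegral_negLogHsia_le [CompleteSpace K] : ∃ M : ℝ≥0∞, M ≠ ⊤ ∧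
    ∀ σ : Measure (BerkP1 K), ∃ a : K,
      ∫⁻ y, negLogHsia (incl (a : OnePoint K)) y ∂σ ≤ M * σ Set.univ := by
  obtain ⟨t, ht0, ht⟩ := NormedField.exists_norm_lt K (show (0 : ℝ) < 1 / 6 by norm_num)
  refine ⟨ENNReal.ofReal (Real.log 12 - Real.log ‖t‖) + ENNReal.ofReal (-Real.log ‖t‖) * 2,
    by finiteness, fun σ => ?_⟩
  obtain ⟨a, ha, hσ⟩ := exists_center_small_discs σ ht0 ht
  refine ⟨a, (lintegral_mono (negLogHsia_le_tsum ht0 ht ha)).trans ?_⟩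
  rw [lintegral_add_left measurable_const, lintegral_const, lintegral_tsum fun i =>
    (measurable_const.indicator (measurableSet_openDisc _ _)).aemeasurable, add_mul]
  gcongr
  calc _ = ∑' i : ℕ, ENNReal.ofReal (-Real.log ‖t‖) * σ (openDisc a (‖t‖ ^ i)) :=
        tsum_congr fun i => lintegral_indicator_const (measurableSet_openDisc _ _) _
    _ ≤ ∑' i : ℕ, ENNReal.ofReal (-Real.log ‖t‖) * (2⁻¹ ^ i * σ Set.univ) :=
        ENNReal.tsum_le_tsum fun i => by gcongr; exact hσ i
    _ = _ := by
      rw [ENNReal.tsum_mul_left, ENNReal.tsum_mul_right, ENNReal.tsum_geometric,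
        ENNReal.one_sub_inv_two, inv_inv, mul_assoc]

theorem exists_lintegral_negLogHsia_le_avoiding [CompleteSpace K] : ∃ M : ℝ, ∀ (σ : Measure (BerkP1 K))
    [IsProbabilityMeasure σ] (S : Finset (OnePoint K)), ∃ a : OnePoint K, a ∉ S ∧
      ∫⁻ y, negLogHsia (incl a) y ∂σ ≤ ENNReal.ofReal M := by
  obtain ⟨M, hM, h⟩ := exists_lintegral_negLogHsia_le K
  refine ⟨(M * 2).toReal, fun σ _ S => ?_⟩
  rw [ENNReal.ofReal_toReal (by finiteness)]
  set ν : Measure (BerkP1 K) := (S.card : ℝ≥0∞)⁻¹ • ∑ q ∈ S, Measure.dirac (incl q) with hν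
  have hν1 : ν Set.univ ≤ 1 := by
    rw [hν, Measure.smul_apply, Measure.finsetSum_apply]
    simp [ENNReal.inv_mul_le_one]
  obtain ⟨a, ha⟩ := h (σ + ν)
  have hle : ∫⁻ y, negLogHsia (incl (a : OnePoint K)) y ∂(σ + ν) ≤ M * 2 := by
    refine ha.trans ?_
    gcongr
    rw [Measure.add_apply, measure_univ, ← one_add_one_eq_two]
    gcongr
  rw [lintegral_add_measure] at hle
  refine ⟨a, fun haS => ?_, le_self_add.trans hle⟩
  have h1 : ∫⁻ y, negLogHsia (incl (a : OnePoint K)) y ∂ν = ⊤ := by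
    rw [hν, lintegral_smul_measure, lintegral_finsetSum_measure]
    have : ∑ q ∈ S, ∫⁻ y, negLogHsia (incl (a : OnePoint K)) y ∂Measure.dirac (incl q) = ⊤ := by
      rw [ENNReal.sum_eq_top]
      refine ⟨a, haS, ?_⟩
      rw [lintegral_dirac' _ (measurable_negLogHsia _), negLogHsia_incl_self]
    rw [this, smul_eq_mul, ENNReal.mul_top (by simp)]
  rw [h1, add_top, top_le_iff] at hle
  exact (by finiteness : M * 2 ≠ ⊤) hle

end BoundedPotential

/-! ### The integral of the proximity function -/

section Integral

variable {K : Type*} [NormedField K] {g : BerkP1 K → ℝ}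
  {μ : Measure (BerkP1 K)}

theorem integrable_of_continuous [IsFiniteMeasure μ] {φ : BerkP1 K → ℝ} (hφ : Continuous φ) :
    Integrable φ μ := by
  obtain ⟨B, hB⟩ := (isCompact_univ.image hφ.norm).bddAbove
  exact Integrable.of_bound hφ.measurable.aestronglyMeasurable B
    (Eventually.of_forall fun x => hB ⟨x, Set.mem_univ x, rfl⟩)

theorem integrable_sum_weightedKernel {C : ℝ} (h : ∀ w : OnePoint K,
    Integrable (weightedKernel g w) μ ∧ ∫ x, weightedKernel g w x ∂μ = C)
    (W : Multiset (OnePoint K)) :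
    Integrable (fun x => (W.map fun w => weightedKernel g w x).sum) μ ∧
      ∫ x, (W.map fun w => weightedKernel g w x).sum ∂μ = W.card * C := by
  induction W using Multiset.induction_on with
  | empty => simp
  | cons w W ih =>
    simp only [Multiset.map_cons, Multiset.sum_cons, Multiset.card_cons]
    refine ⟨(h w).1.add ih.1, ?_⟩
    rw [integral_add (h w).1 ih.1, (h w).2, ih.2]
    push_cast
    ring

theorem ae_forall_mem_multiset {p : OnePoint K → BerkP1 K → Prop} (h : ∀ w, ∀ᵐ x ∂μ, p w x)
    (W : Multiset (OnePoint K)) : ∀ᵐ x ∂μ, ∀ w ∈ W, p w x := by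
  induction W using Multiset.induction_on with
  | empty => simp
  | cons w W ih =>
    filter_upwards [h w, ih] with x h1 h2 w' hw'
    rcases Multiset.mem_cons.1 hw' with rfl | h'
    · exact h1
    · exact h2 w' h'

theorem exists_eq_liftGreen_add {f : RatFunc K} (hg : IsDynamicalGreen f g) :
    ∃ κ : ℝ, ∀ x, g x = liftGreen f x + κ := by
  obtain ⟨⟨μ, h1, h2⟩, -⟩ := hg
  obtain ⟨c₁, hc₁⟩ := h1.potential
  obtain ⟨c₂, hc₂⟩ := h2.potential
  refine ⟨c₂ - c₁, fun x => ?_⟩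
  have := EReal.coe_injective ((hc₁ x).symm.trans (hc₂ x))
  linarith

theorem integral_sub_sub_const {X : Type*} [MeasurableSpace X] {ν : Measure X}
    [IsProbabilityMeasure ν] {φ ψ : X → ℝ} (hφ : Integrable φ ν) (hψ : Integrable ψ ν) (c : ℝ) :
    ∫ x, (φ x - ψ x - c) ∂ν = ∫ x, φ x ∂ν - ∫ x, ψ x ∂ν - c := by
  rw [integral_sub (f := fun x => φ x - ψ x) (hφ.sub hψ) (integrable_const _),
    integral_sub hφ hψ]
  simp

end Integral

section Proximity

variable {K : Type*} [NontriviallyNormedField K] [IsAlgClosed K] {g : BerkP1 K → ℝ}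
  {μ : Measure (BerkP1 K)}

/-- The weighted potential of `μ^g` is constant on `ℙ¹`. -/
theorem IsWeight.exists_integral_weightedKernel (h : IsWeight g μ) : ∃ C : ℝ, ∀ w : OnePoint K,
    (∀ᵐ x ∂μ, 0 < berkChordal w x) ∧ Integrable (weightedKernel g w) μ ∧
      ∫ x, weightedKernel g w x ∂μ = C := by
  obtain ⟨c, hc⟩ := h.potential
  have := h.isProbabilityMeasure
  have hgi := integrable_of_continuous (μ := μ) h.continuous
  refine ⟨-c - ∫ x, g x ∂μ, fun w => ?_⟩
  have hw := hc (incl w)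
  have hne : ∫⁻ x, negLogHsia (incl w) x ∂μ ≠ ⊤ := by
    intro htop
    rw [htop, EReal.coe_ennreal_top] at hw
    exact EReal.coe_ne_top _ hw.symm
  have hr : (∫⁻ x, negLogHsia (incl w) x ∂μ).toReal = c - g (incl w) := by
    have := congrArg EReal.toReal hw
    rwa [EReal.toReal_coe_ennreal, EReal.toReal_coe] at this
  obtain ⟨h1, h2, h3⟩ := integrable_log_berkChordal hne
  refine ⟨h1, (h2.sub hgi).sub (integrable_const _), ?_⟩
  unfold weightedKernel
  rw [integral_sub_sub_const h2 hgi, h3, hr]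
  ring

variable {f : RatFunc K}

theorem integrable_logProx_liftGreen (hf : 1 < ratDegree f) (hμ : IsEquilibriumMeasure f μ) {n : ℕ}
    (hn : n ≠ 0) : (∀ᵐ x ∂μ, 0 < prox f n x) ∧ Integrable (logProx f (liftGreen f) n) μ := by
  obtain ⟨C, hC⟩ := hμ.exists_integral_weightedKernel
  obtain ⟨W, -, s, h1, h2⟩ := exists_logProx_eq hf hμ.continuous hn
  have := hμ.isProbabilityMeasure
  have hpos : ∀ᵐ x ∂μ, 0 < prox f n x :=
    (ae_forall_mem_multiset (fun w => (hC w).1) W).mono fun x hx => (h1 x).2 hx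
  refine ⟨hpos, ((integrable_sum_weightedKernel (fun w => (hC w).2) W).1.add
    (integrable_const s)).congr ?_⟩
  filter_upwards [hpos] with x hx using (h2 x hx).symm

/-- The integrals of the proximity functions, weighted by the Green function of the lift, are
bounded. -/
theorem exists_abs_integral_logProx_le [CompleteSpace K] (hf : 1 < ratDegree f)
    (hμ : IsEquilibriumMeasure f μ) :
    ∃ M : ℝ, ∀ n : ℕ, n ≠ 0 → |∫ x, logProx f (liftGreen f) n x ∂μ| ≤ M := by
  classical
  have hprob := hμ.isProbabilityMeasure
  have hgc := hμ.continuous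
  obtain ⟨C, hC⟩ := hμ.exists_integral_weightedKernel
  obtain ⟨M, hM⟩ := exists_lintegral_negLogHsia_le_avoiding K
  obtain ⟨B, hB⟩ := (isCompact_univ.image hgc.abs).bddAbove
  have hB' : ∀ x, |liftGreen f x| ≤ B := fun x => hB ⟨x, Set.mem_univ x, rfl⟩
  have hB0 : 0 ≤ B := (abs_nonneg _).trans (hB' (Classical.arbitrary _))
  refine ⟨2 * (max M 0 + 2 * B) + |C|, fun n hn => ?_⟩
  obtain ⟨Q, hQ, t, hQ1, hQ2⟩ := exists_logProx_eq hf hgc hn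
  have hiter : Continuous ((berkMap f)^[n]) := (continuous_berkMap f).iterate n
  have hmap : IsProbabilityMeasure (μ.map ((berkMap f)^[n])) :=
    Measure.isProbabilityMeasure_map hiter.measurable.aemeasurable
  obtain ⟨a, haQ, ha⟩ := hM (μ.map ((berkMap f)^[n])) Q.toFinset
  have hchordal : ∀ z w : OnePoint K, 0 < chordal z w ↔ z ≠ w := fun z w =>
    ⟨fun h hzw => by rw [hzw, chordal_self] at h; exact h.false, chordal_pos⟩
  have hfix : ∀ z : OnePoint K, (ratMap f)^[n] z ≠ z ↔ z ∉ Q := by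
    intro z
    rw [← hchordal, ← prox_incl, hQ1]
    simp only [berkChordal_incl, hchordal]
    exact ⟨fun h hz => h z hz rfl, fun h w hw hzw => h (hzw ▸ hw)⟩
  have hafix : (ratMap f)^[n] a ≠ a := (hfix a).2 fun h => haQ (Multiset.mem_toFinset.2 h)
  obtain ⟨W, hW, s, hW1, hW2⟩ := exists_weightedKernel_iterate_eq hf hgc n hafix
  have hrel : (((ratDegree f ^ n : ℕ) : ℝ) - 1) * t = (ratDegree f ^ n : ℕ) * s := by
    refine constant_relation (F := (ratMap f)^[n])
      (φ := fun z w => weightedKernel (liftGreen f) w (incl z))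
      (fun z w => weightedKernel_comm _ z w) hafix hW hQ (fun b hb => ?_) (fun q hq => ?_)
      (fun z hz => ?_) (fun z hz => ?_)
    · by_contra hne
      have := (hW1 (incl b)).1 (by
        rw [berkMap_iterate_incl, berkChordal_incl]; exact chordal_pos hne) b hb
      rw [berkChordal_incl, chordal_self] at this
      exact this.false
    · by_contra hne
      exact (hfix q).1 hne hq
    · have := hW2 (incl z) (by rw [berkMap_iterate_incl, berkChordal_incl]; exact chordal_pos hz)
      rwa [berkMap_iterate_incl] at this
    · have := hQ2 (incl z) (by rw [prox_incl]; exact chordal_pos hz)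
      rw [← this, logProx, prox_incl, berkMap_iterate_incl, weightedKernel, berkChordal_incl]
  have hpull : ∫⁻ x, negLogHsia (incl a) x ∂(μ.map ((berkMap f)^[n])) ≠ ⊤ :=
    (ha.trans_lt ENNReal.ofReal_lt_top).ne
  obtain ⟨-, hi2, hi3⟩ := integrable_log_berkChordal hpull
  have hi2' : Integrable (fun x => Real.log (berkChordal a ((berkMap f)^[n] x))) μ :=
    hi2.comp_measurable hiter.measurable
  rw [integral_map hiter.measurable.aemeasurable hi2.1] at hi3
  have hgi : Integrable (fun x => liftGreen f ((berkMap f)^[n] x)) μ :=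
    integrable_of_continuous (hgc.comp hiter)
  set ε := ∫ x, weightedKernel (liftGreen f) a ((berkMap f)^[n] x) ∂μ with hε
  have hε1 : ε = ratDegree f ^ n * C + s := by
    have h1 : ∀ᵐ x ∂μ, weightedKernel (liftGreen f) a ((berkMap f)^[n] x) =
        (W.map fun w => weightedKernel (liftGreen f) w x).sum + s := by
      filter_upwards [ae_forall_mem_multiset (fun w => (hC w).1) W] with x hx
      exact hW2 x ((hW1 x).2 hx)
    obtain ⟨h2, h3⟩ := integrable_sum_weightedKernel (fun w => (hC w).2) W
    rw [hε, integral_congr_ae h1, integral_add h2 (integrable_const s), h3, hW]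
    simp
  have hε2 : |ε| ≤ max M 0 + 2 * B := by
    have h1 : ε = -(∫⁻ x, negLogHsia (incl a) x ∂(μ.map ((berkMap f)^[n]))).toReal -
        ∫ x, liftGreen f ((berkMap f)^[n] x) ∂μ - liftGreen f (incl a) := by
      rw [hε]
      unfold weightedKernel
      rw [integral_sub_sub_const hi2' hgi, hi3]
    have h2 : (∫⁻ x, negLogHsia (incl a) x ∂(μ.map ((berkMap f)^[n]))).toReal ≤ max M 0 :=
      (ENNReal.toReal_mono ENNReal.ofReal_ne_top ha).trans_eq ENNReal.toReal_ofReal'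
    have h3 : |∫ x, liftGreen f ((berkMap f)^[n] x) ∂μ| ≤ B := by
      have := norm_integral_le_of_norm_le_const (μ := μ) (f := fun x =>
        liftGreen f ((berkMap f)^[n] x)) (Eventually.of_forall fun x => hB' _)
      simpa using this
    have h4 := hB' (incl a)
    have h5 := ENNReal.toReal_nonneg (a := ∫⁻ x, negLogHsia (incl a) x ∂(μ.map ((berkMap f)^[n])))
    rw [h1]
    rw [abs_le] at h3 h4 ⊢
    constructor <;> linarith
  have hI : ∫ x, logProx f (liftGreen f) n x ∂μ = (ratDegree f ^ n + 1) * C + t := by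
    have h1 : ∀ᵐ x ∂μ, logProx f (liftGreen f) n x =
        (Q.map fun w => weightedKernel (liftGreen f) w x).sum + t := by
      filter_upwards [ae_forall_mem_multiset (fun w => (hC w).1) Q] with x hx
      exact hQ2 x ((hQ1 x).2 hx)
    obtain ⟨h2, h3⟩ := integrable_sum_weightedKernel (fun w => (hC w).2) Q
    rw [integral_congr_ae h1, integral_add h2 (integrable_const t), h3, hQ]
    simp
  have hD : (2 : ℝ) ≤ (ratDegree f : ℝ) ^ n := by
    exact_mod_cast Nat.succ_le_of_lt (Nat.one_lt_pow hn hf)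
  push_cast at hrel
  set D : ℝ := (ratDegree f : ℝ) ^ n
  have hfin : (D - 1) * ∫ x, logProx f (liftGreen f) n x ∂μ = D * ε - C := by
    rw [hI, hε1]; linear_combination hrel
  have habs : (D - 1) * |∫ x, logProx f (liftGreen f) n x ∂μ| ≤ D * |ε| + |C| := by
    rw [← abs_of_pos (show 0 < D - 1 by linarith), ← abs_mul, hfin]
    refine (abs_sub _ _).trans ?_
    rw [abs_mul, abs_of_pos (show 0 < D by linarith)]
  have h6 : 0 ≤ |C| := abs_nonneg C
  have h7 : 0 ≤ |ε| := abs_nonneg ε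
  refine le_of_mul_le_mul_left (habs.trans ?_) (show 0 < D - 1 by linarith)
  have h8 : D * |ε| ≤ (D - 1) * (2 * (max M 0 + 2 * B)) := by nlinarith
  nlinarith

end Proximity

end BerkDyn

end

theorem proximity_integral_linear_growth {K : Type*} [NontriviallyNormedField K]
    [IsAlgClosed K] [CharZero K] [CompleteSpace K]
    (f : RatFunc K) (hf : 1 < BerkDyn.ratDegree f)
    (μ : Measure (BerkDyn.BerkP1 K)) (hμ : BerkDyn.IsEquilibriumMeasure f μ)
    (g : BerkDyn.BerkP1 K → ℝ) (hg : BerkDyn.IsDynamicalGreen f g) :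
    (∀ n : ℕ, 1 ≤ n →
      (∀ᵐ x ∂μ, 0 < BerkDyn.prox f n x) ∧ Integrable (BerkDyn.logProx f g n) μ) ∧
    (fun n : ℕ => ∫ x, BerkDyn.logProx f g n x ∂μ) =O[atTop] (fun n : ℕ => (n : ℝ)) := by
  obtain ⟨κ, hκ⟩ := BerkDyn.exists_eq_liftGreen_add hg
  have := hμ.isProbabilityMeasure
  have heq : ∀ n, BerkDyn.logProx f g n =
      fun x => BerkDyn.logProx f (BerkDyn.liftGreen f) n x - 2 * κ := fun n => funext fun x => by
    simp only [BerkDyn.logProx, hκ]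
    ring
  have hint := fun (n : ℕ) (hn : 1 ≤ n) =>
    BerkDyn.integrable_logProx_liftGreen hf hμ (n := n) (Nat.one_le_iff_ne_zero.1 hn)
  refine ⟨fun n hn => ⟨(hint n hn).1, ?_⟩, ?_⟩
  · rw [heq]
    exact (hint n hn).2.sub (integrable_const _)
  · obtain ⟨M, hM⟩ := BerkDyn.exists_abs_integral_logProx_le hf hμ
    refine IsBigO.of_bound (M + |2 * κ|) ?_
    filter_upwards [eventually_ge_atTop 1] with n hn
    have hn' : (1 : ℝ) ≤ n := by exact_mod_cast hn
    have h1 := hM n (Nat.one_le_iff_ne_zero.1 hn)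
    have h2 : 0 ≤ M + |2 * κ| := add_nonneg ((abs_nonneg _).trans h1) (abs_nonneg _)
    rw [heq, integral_sub (hint n hn).2 (integrable_const _), Real.norm_eq_abs, Real.norm_natCast]
    calc _ ≤ M + |2 * κ| := by
          refine (abs_sub _ _).trans (add_le_add h1 ?_)
          simp
      _ ≤ (M + |2 * κ|) * n := le_mul_of_one_le_right h2 hn'
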